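/- arXiv:2511.03458 — 13 statements merged into one kernel-verified Lean document; each statement's English description precedes it below -/
import Mathlib

section
/- Let V be a valuation ring (an integral domain in which, for any two elements, one divides the other) and let p ∈ V be a nonzero element such that ⋂_{n≥0} p^n V = 0. Then the localization V[1/p] of V at the powers of p is a field; equivalently, V[1/p] coincides with the fraction field of V, i.e. for every element f of the fraction field of V there exists N ≥ 0 such that p^N f ∈ V. -/
/-- In a valuation ring that is separated for the `p`-adic topology, every nonzero element divides
a power of `p`. -/
theorem ValuationRing.exists_dvd_pow_of_separated {V : Type*} [CommRing V] [IsDomain V]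
    [ValuationRing V] {p : V} (hsep : ∀ x : V, (∀ n : ℕ, p ^ n ∣ x) → x = 0)
    {x : V} (hx : x ≠ 0) : ∃ n : ℕ, x ∣ p ^ n := by
  by_contra! h
  exact hx (hsep x fun n => (ValuationRing.dvd_total (p ^ n) x).resolve_right (h n))

/-- Let `V` be a valuation ring and `p ∈ V` a nonzero element with
`⋂ₙ pⁿV = 0`.  Then the localization `V[1/p]` is a field; equivalently, `V[1/p]` is the
fraction field of `V`: every element `f` of the fraction field satisfies `p^N f ∈ V` for
some `N ≥ 0`. -/
theorem valuationRing_localization_away_isField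
    (V : Type*) [CommRing V] [IsDomain V] [ValuationRing V]
    (p : V) (hp : p ≠ 0)
    (hsep : ∀ x : V, (∀ n : ℕ, p ^ n ∣ x) → x = 0) :
    IsField (Localization.Away p) ∧
      ∀ f : FractionRing V, ∃ (N : ℕ) (v : V),
        algebraMap V (FractionRing V) v = algebraMap V (FractionRing V) p ^ N * f := by
  refine ⟨?_, fun f => ?_⟩
  · have hle : Submonoid.powers p ≤ nonZeroDivisors V :=
      powers_le_nonZeroDivisors_of_noZeroDivisors hp
    have : IsDomain (Localization.Away p) := IsLocalization.isDomain_localization hle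
    refine ⟨exists_pair_ne _, mul_comm, fun {a} ha => ?_⟩
    obtain ⟨x, s, rfl⟩ := IsLocalization.exists_mk'_eq (Submonoid.powers p) a
    have hx : x ≠ 0 := by
      rintro rfl
      exact ha (IsLocalization.mk'_zero s)
    obtain ⟨n, c, hc⟩ := ValuationRing.exists_dvd_pow_of_separated hsep hx
    have hunit : IsUnit (algebraMap V (Localization.Away p) x) := by
      refine isUnit_of_dvd_unit (map_dvd _ ⟨c, hc⟩) ?_
      exact IsLocalization.map_units _ (⟨p ^ n, n, rfl⟩ : Submonoid.powers p)
    rw [← IsLocalization.mk'_spec (Localization.Away p) x s] at hunit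
    exact (isUnit_of_mul_isUnit_left hunit).exists_right_inv
  · obtain ⟨a, b, hb, rfl⟩ := IsFractionRing.div_surjective (A := V) f
    have hb0 : b ≠ 0 := nonZeroDivisors.ne_zero hb
    obtain ⟨n, c, hc⟩ := ValuationRing.exists_dvd_pow_of_separated hsep hb0
    refine ⟨n, c * a, ?_⟩
    have hb' : algebraMap V (FractionRing V) b ≠ 0 := by
      simpa using hb0
    rw [← map_pow, hc, map_mul, map_mul]
    field_simp
end

section
/- Let p be a prime and V a valuation ring in which p is a nonzero nonunit, and assume that for every n ≥ 1 there exists π ∈ V with π^n = p. Let K be the fraction field of V and let 𝔭 = √(pV) be the radical of the principal ideal generated by p; 𝔭 is a prime ideal of V. Call an element f ∈ K power-bounded if there exists N ≥ 0 such that p^N f^m ∈ V for all m ≥ 0. Then: (1) the set of power-bounded elements of K equals the image of the localization of V at 𝔭 inside K, that is, it equals { a/s : a ∈ V, s ∈ V ∖ 𝔭 }; (2) for every power-bounded f ∈ K and every ε ∈ 𝔭 one has ε·f ∈ V; in particular p·f ∈ V for every power-bounded f, so the power-bounded elements form a bounded subring of K. -/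
/-- In a valuation ring every radical ideal other than the unit ideal is prime. -/
theorem ValuationRing.isPrime_radical {V : Type*} [CommRing V] [IsDomain V] [ValuationRing V]
    {I : Ideal V} (hI : I ≠ ⊤) : I.radical.IsPrime := by
  refine ⟨fun h => hI (Ideal.radical_eq_top.mp h), fun {x y} hxy => ?_⟩
  rcases ValuationRing.dvd_total x y with ⟨z, rfl⟩ | ⟨z, rfl⟩
  · right
    refine Ideal.mem_radical_of_pow_mem (m := 2) (Ideal.mem_of_dvd _ ⟨z, ?_⟩ hxy)
    ring
  · left
    refine Ideal.mem_radical_of_pow_mem (m := 2) (Ideal.mem_of_dvd _ ⟨z, ?_⟩ hxy)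
    ring

section PowerBounded

variable {V K : Type*} [CommRing V] [Field K] [Algebra V K]

/-- If `ε` lies in the radical of `(ϖ)` and `ϖ ^ N * f ^ m` is integral for all `m`, then
some positive power of `ε * f` is `ϖ` times an element of `V`. -/
theorem exists_pow_eq_mul_of_mem_radical {ϖ ε : V} {f : K} {N : ℕ}
    (hf : ∀ m : ℕ, ∃ v : V, algebraMap V K v = algebraMap V K ϖ ^ N * f ^ m)
    (hε : ε ∈ (Ideal.span {ϖ}).radical) :
    ∃ n : ℕ, 0 < n ∧ ∃ v : V, algebraMap V K (ϖ * v) = (algebraMap V K ε * f) ^ n := by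
  obtain ⟨k, hk⟩ := hε
  obtain ⟨w, hw⟩ := Ideal.mem_span_singleton.mp hk
  obtain ⟨v, hv⟩ := hf ((k + 1) * (N + 1))
  refine ⟨(k + 1) * (N + 1), by positivity, (w * ε) ^ (N + 1) * v, ?_⟩
  have h : ε ^ ((k + 1) * (N + 1)) = ϖ ^ N * ϖ * (w * ε) ^ (N + 1) := by
    rw [pow_mul, pow_succ ε k, hw]
    ring
  rw [mul_pow (algebraMap V K ε), ← map_pow, h]
  simp only [map_mul, map_pow, hv]
  ring

variable [IsDomain V] [ValuationRing V]

theorem exists_algebraMap_eq_mul_pow {ϖ a s : V} {f : K}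
    (hs : s ∉ (Ideal.span {ϖ}).radical) (hf : f * algebraMap V K s = algebraMap V K a)
    (m : ℕ) : ∃ v : V, algebraMap V K v = algebraMap V K ϖ * f ^ m := by
  have hdvd : s ^ m ∣ ϖ := (ValuationRing.dvd_total (s ^ m) ϖ).resolve_right
    fun h => hs ⟨m, Ideal.mem_span_singleton.mpr h⟩
  obtain ⟨t, rfl⟩ := hdvd
  refine ⟨t * a ^ m, ?_⟩
  simp only [map_mul, map_pow, ← hf]
  ring

variable [IsFractionRing V K]

theorem exists_algebraMap_eq_mul_of_mem_radical {ϖ ε : V} {f : K} {N : ℕ}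
    (hf : ∀ m : ℕ, ∃ v : V, algebraMap V K v = algebraMap V K ϖ ^ N * f ^ m)
    (hε : ε ∈ (Ideal.span {ϖ}).radical) :
    ∃ v : V, algebraMap V K v = algebraMap V K ε * f := by
  obtain ⟨n, hn, v, hv⟩ := exists_pow_eq_mul_of_mem_radical hf hε
  exact IsIntegrallyClosed.exists_algebraMap_eq_of_isIntegral_pow hn
    (hv ▸ isIntegral_algebraMap)

theorem exists_mul_eq_of_powerBounded {ϖ : V} (hϖ : ¬ IsUnit ϖ) {f : K} {N : ℕ}
    (hf : ∀ m : ℕ, ∃ v : V, algebraMap V K v = algebraMap V K ϖ ^ N * f ^ m) :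
    ∃ a s : V, s ∉ (Ideal.span {ϖ}).radical ∧ f * algebraMap V K s = algebraMap V K a := by
  rcases ValuationRing.isInteger_or_isInteger V f with ⟨a, ha⟩ | ⟨s, hs⟩
  · refine ⟨a, 1, fun h => hϖ ?_, by simp [ha]⟩
    rwa [← Ideal.eq_top_iff_one, Ideal.radical_eq_top, Ideal.span_singleton_eq_top] at h
  · rcases eq_or_ne f 0 with rfl | hf0
    · refine ⟨0, 1, fun h => hϖ ?_, by simp⟩
      rwa [← Ideal.eq_top_iff_one, Ideal.radical_eq_top, Ideal.span_singleton_eq_top] at h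
    refine ⟨1, s, fun h => hϖ ?_, by simp [hs, hf0]⟩
    obtain ⟨n, -, v, hv⟩ := exists_pow_eq_mul_of_mem_radical hf h
    rw [hs, inv_mul_cancel₀ hf0, one_pow, ← map_one (algebraMap V K)] at hv
    exact IsUnit.of_mul_eq_one v (IsFractionRing.injective V K hv)

end PowerBounded


/-- Let `V` be a valuation ring in which the prime `p` is a nonzero
nonunit admitting `n`-th roots for all `n ≥ 1`, `K` its fraction field, and
`𝔭 = √(pV)` (a prime ideal).  An element `f ∈ K` is power-bounded if `p^N fᵐ ∈ V` for
some `N` and all `m`.  Then (1) the power-bounded elements are exactly the fractions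
`a/s` with `a ∈ V`, `s ∈ V ∖ 𝔭`, i.e. the image of the localization `V_𝔭` in `K`, and
(2) for every power-bounded `f` and every `ε ∈ 𝔭` one has `ε·f ∈ V`; in particular the
power-bounded elements form a bounded subring of `K`. -/
theorem powerBounded_of_valuation_ring
    (p : ℕ) (hp : p.Prime) (V : Type*) [CommRing V] [IsDomain V] [ValuationRing V]
    (hp0 : (p : V) ≠ 0) (hpu : ¬ IsUnit (p : V))
    (hroot : ∀ n : ℕ, 1 ≤ n → ∃ π : V, π ^ n = (p : V)) :
    (Ideal.span {(p : V)}).radical.IsPrime ∧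
    (∀ f : FractionRing V,
      ((∃ N : ℕ, ∀ m : ℕ, ∃ v : V, algebraMap V (FractionRing V) v =
          algebraMap V (FractionRing V) (p : V) ^ N * f ^ m) ↔
        ∃ a s : V, s ∉ (Ideal.span {(p : V)}).radical ∧
          f * algebraMap V (FractionRing V) s = algebraMap V (FractionRing V) a)) ∧
    (∀ f : FractionRing V,
      (∃ N : ℕ, ∀ m : ℕ, ∃ v : V, algebraMap V (FractionRing V) v =
          algebraMap V (FractionRing V) (p : V) ^ N * f ^ m) →
      ∀ ε ∈ (Ideal.span {(p : V)}).radical,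
        ∃ v : V, algebraMap V (FractionRing V) v = algebraMap V (FractionRing V) ε * f) := by
  refine ⟨ValuationRing.isPrime_radical (by rwa [Ne, Ideal.span_singleton_eq_top]),
    fun f => ⟨fun ⟨N, hf⟩ => exists_mul_eq_of_powerBounded hpu hf, fun ⟨a, s, hs, hf⟩ =>
      ⟨1, fun m => ?_⟩⟩,
    fun f ⟨N, hf⟩ ε hε => exists_algebraMap_eq_mul_of_mem_radical hf hε⟩
  rw [pow_one]
  exact exists_algebraMap_eq_mul_pow hs hf m
end

section
/- Let p be a prime, A a commutative ring, and let M and N be A-modules that are p-torsion-free and p-adically complete; regard M as a subset of M[1/p] and N as a subset of N[1/p]. Let f : M[1/p] → N[1/p] be an A-linear map such that f(M) ⊆ N and f is surjective. Then f is open for the p-adic topologies: there exists k ≥ 0 such that p^k N ⊆ f(M). -/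
section PrincipalAdic

variable {A M N : Type*} [CommRing A] [AddCommGroup M] [Module A M] [AddCommGroup N] [Module A N]

/-- Congruence modulo a power of a principal ideal, spelled out. -/
theorem sModEq_span_singleton_pow_iff {a : A} {i : ℕ} {x y : M} :
    x ≡ y [SMOD (Ideal.span {a} ^ i • ⊤ : Submodule A M)] ↔ ∃ z, x = y + a ^ i • z := by
  rw [SModEq.sub_mem, Ideal.span_singleton_pow, Submodule.ideal_span_singleton_smul,
    Submodule.mem_smul_pointwise_iff_exists]
  simp only [Submodule.mem_top, true_and, eq_sub_iff_add_eq', eq_comm]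

/-- A series `∑ aⁱ yᵢ` converges in an `a`-adically precomplete module. -/
theorem IsPrecomplete.exists_limit_of_span_singleton {a : A} [IsPrecomplete (Ideal.span {a}) M]
    (x : ℕ → M) (hx : ∀ i, ∃ y, x (i + 1) = x i + a ^ i • y) :
    ∃ l, ∀ i, ∃ z, l = x i + a ^ i • z := by
  have hcauchy : ∀ i d, ∃ z, x (i + d) = x i + a ^ i • z := by
    intro i d
    induction d with
    | zero => exact ⟨0, by simp⟩
    | succ d ih =>
      obtain ⟨z, hz⟩ := ih
      obtain ⟨y, hy⟩ := hx (i + d)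
      refine ⟨z + a ^ d • y, ?_⟩
      rw [← add_assoc, hy, hz, smul_add, smul_smul, ← pow_add, add_assoc]
  obtain ⟨l, hl⟩ := IsPrecomplete.prec ‹IsPrecomplete (Ideal.span {a}) M› (f := x) (by
    intro m n hmn
    obtain ⟨d, rfl⟩ := Nat.exists_eq_add_of_le hmn
    exact (sModEq_span_singleton_pow_iff.2 (hcauchy m d)).symm)
  exact ⟨l, fun i ↦ sModEq_span_singleton_pow_iff.1 (hl i).symm⟩

theorem IsHausdorff.eq_of_forall_eq_add_pow_smul {a : A} [IsHausdorff (Ideal.span {a}) M]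
    {x y : M} (h : ∀ i, ∃ z, x = y + a ^ i • z) : x = y :=
  (IsHausdorff.eq_iff_smodEq (I := Ideal.span {a})).2 fun i ↦
    sModEq_span_singleton_pow_iff.2 (h i)

/-- Successive approximation: if every element of `aʲN` is approximated to first order by the
range of `g`, then `aʲN` is contained in the range. -/
theorem LinearMap.pow_smul_mem_range_of_approx {a : A} [IsPrecomplete (Ideal.span {a}) M]
    [IsHausdorff (Ideal.span {a}) N] (g : M →ₗ[A] N) {j : ℕ}
    (h : ∀ n : N, ∃ m n', a ^ j • n = g m + a ^ (j + 1) • n') (n : N) :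
    a ^ j • n ∈ LinearMap.range g := by
  choose u r hur using h
  let s : ℕ → M := fun i ↦ ∑ l ∈ Finset.range i, a ^ l • u (r^[l] n)
  have hs : ∀ i, a ^ j • n = g (s i) + a ^ i • a ^ j • r^[i] n := by
    intro i
    induction i with
    | zero => simp [s]
    | succ i ih =>
      rw [ih, hur (r^[i] n), Function.iterate_succ_apply']
      simp only [s, Finset.sum_range_succ, map_add, map_smul, smul_add, smul_smul, add_assoc]
      congr 3
      ring
  obtain ⟨l, hl⟩ := IsPrecomplete.exists_limit_of_span_singleton (a := a) s
    fun i ↦ ⟨_, Finset.sum_range_succ _ i⟩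
  refine ⟨l, IsHausdorff.eq_of_forall_eq_add_pow_smul (a := a) fun i ↦ ?_⟩
  obtain ⟨z, hz⟩ := hl i
  refine ⟨g z - a ^ j • r^[i] n, ?_⟩
  rw [hs i, hz, map_add, map_smul, smul_sub]
  abel

/-- If `N` is `a`-adically precomplete and the cokernel of `g` is `a`-power torsion, then the
filtration of the cokernel by powers of `a` is stationary somewhere. -/
theorem LinearMap.exists_approx_of_forall_pow_smul_mem_range {a : A}
    [IsPrecomplete (Ideal.span {a}) N] (g : M →ₗ[A] N)
    (h : ∀ n : N, ∃ k : ℕ, a ^ k • n ∈ LinearMap.range g) :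
    ∃ j : ℕ, ∀ n : N, ∃ m n', a ^ j • n = g m + a ^ (j + 1) • n' := by
  by_contra! hne
  choose y hy using hne
  choose K hK using h
  let x : ℕ → N := fun i ↦ Nat.rec 0 (fun i v ↦ v + a ^ i • y (K v + i + i)) i
  have hx : ∀ i, x (i + 1) = x i + a ^ i • y (K (x i) + i + i) := fun _ ↦ rfl
  obtain ⟨l, hl⟩ := IsPrecomplete.exists_limit_of_span_singleton (a := a) x fun i ↦ ⟨_, hx i⟩
  obtain ⟨i, hi⟩ : ∃ i, i = K l := ⟨_, rfl⟩
  obtain ⟨z, hz⟩ := hl (i + 1)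
  rw [hx] at hz
  have h₁ : a ^ (K (x i) + i) • l ∈ LinearMap.range g := by
    rw [pow_add, mul_smul]
    exact Submodule.smul_mem _ _ (hi ▸ hK l)
  have h₂ : a ^ (K (x i) + i) • x i ∈ LinearMap.range g := by
    rw [add_comm, pow_add, mul_smul]
    exact Submodule.smul_mem _ _ (hK (x i))
  obtain ⟨m, hm⟩ := Submodule.sub_mem _ h₁ h₂
  refine hy (K (x i) + i + i) m (-z) ?_
  have hl' := congrArg (a ^ (K (x i) + i) • ·) hz
  simp only [smul_add, smul_smul, ← pow_add, ← add_assoc] at hl'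
  rw [hm, hl', smul_neg]
  abel

/-- Open mapping theorem for a linear map between adic modules whose cokernel is `a`-power
torsion. -/
theorem LinearMap.exists_pow_smul_mem_range {a : A} [IsPrecomplete (Ideal.span {a}) M]
    [IsAdicComplete (Ideal.span {a}) N] (g : M →ₗ[A] N)
    (h : ∀ n : N, ∃ k : ℕ, a ^ k • n ∈ LinearMap.range g) :
    ∃ k : ℕ, ∀ n : N, a ^ k • n ∈ LinearMap.range g := by
  obtain ⟨j, hj⟩ := g.exists_approx_of_forall_pow_smul_mem_range h
  exact ⟨j, g.pow_smul_mem_range_of_approx hj⟩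

theorem LocalizedModule.mkLinearMap_powers_injective {a : A} (h : ∀ m : M, a • m = 0 → m = 0) :
    Function.Injective (LocalizedModule.mkLinearMap (Submonoid.powers a) M) := by
  rw [← LinearMap.ker_eq_bot, LinearMap.ker_eq_bot']
  intro m hm
  obtain ⟨⟨_, k, rfl⟩, hk⟩ :=
    (IsLocalizedModule.eq_zero_iff (Submonoid.powers a)
      (LocalizedModule.mkLinearMap (Submonoid.powers a) M)).1 hm
  replace hk : a ^ k • m = 0 := hk
  induction k with
  | zero => simpa using hk
  | succ k ih => exact ih (h _ (by rwa [smul_smul, ← pow_succ']))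

end PrincipalAdic


/-- **Banach open mapping theorem for adic modules.**
Let `M, N` be `p`-torsion-free, `p`-adically complete modules over a commutative ring
`A`, and `f : M[1/p] → N[1/p]` an `A`-linear map with `f(M) ⊆ N` which is surjective.
Then `f` is open for the `p`-adic topologies: there is `k ≥ 0` with `p^k N ⊆ f(M)`. -/
theorem banach_open_mapping_adic
    (p : ℕ) (hp : p.Prime) (A : Type*) [CommRing A]
    (M N : Type*) [AddCommGroup M] [Module A M] [AddCommGroup N] [Module A N]
    (htfM : ∀ m : M, (p : A) • m = 0 → m = 0)
    (htfN : ∀ n : N, (p : A) • n = 0 → n = 0)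
    [IsAdicComplete (Ideal.span {(p : A)}) M]
    [IsAdicComplete (Ideal.span {(p : A)}) N]
    (f : LocalizedModule (Submonoid.powers (p : A)) M →ₗ[A]
         LocalizedModule (Submonoid.powers (p : A)) N)
    (hbd : ∀ m : M, ∃ n : N,
      f (LocalizedModule.mkLinearMap (Submonoid.powers (p : A)) M m) =
        LocalizedModule.mkLinearMap (Submonoid.powers (p : A)) N n)
    (hsurj : Function.Surjective f) :
    ∃ k : ℕ, ∀ n : N, ∃ m : M,
      f (LocalizedModule.mkLinearMap (Submonoid.powers (p : A)) M m) =
        ((p : A) ^ k) • LocalizedModule.mkLinearMap (Submonoid.powers (p : A)) N n := by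
  have hinj := LocalizedModule.mkLinearMap_powers_injective htfN
  choose g₀ hg₀ using hbd
  let g : M →ₗ[A] N :=
    { toFun := g₀
      map_add' := fun x y ↦ hinj (by simp only [map_add, ← hg₀])
      map_smul' := fun c x ↦ hinj (by simp only [map_smul, ← hg₀, RingHom.id_apply]) }
  have hg : ∀ m, f (LocalizedModule.mkLinearMap (Submonoid.powers (p : A)) M m) =
      LocalizedModule.mkLinearMap (Submonoid.powers (p : A)) N (g m) := hg₀
  obtain ⟨k, hk⟩ := g.exists_pow_smul_mem_range (a := (p : A)) (by
    intro n
    obtain ⟨w, hw⟩ := hsurj (LocalizedModule.mkLinearMap (Submonoid.powers (p : A)) N n)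
    obtain ⟨⟨m, ⟨_, k, rfl⟩⟩, hm⟩ :=
      IsLocalizedModule.surj (Submonoid.powers (p : A))
        (LocalizedModule.mkLinearMap (Submonoid.powers (p : A)) M) w
    replace hm : (p : A) ^ k • w =
        LocalizedModule.mkLinearMap (Submonoid.powers (p : A)) M m := hm
    exact ⟨k, m, hinj (by rw [← hg, ← hm, map_smul, hw, map_smul])⟩)
  refine ⟨k, fun n ↦ ?_⟩
  obtain ⟨m, hm⟩ := hk n
  exact ⟨m, by rw [hg, hm, map_smul]⟩
end

section
/- Let p be a prime and let M and N be p-torsion-free, p-adically complete abelian groups, regarded as subgroups of M[1/p] and N[1/p] respectively. Let (T_i)_{i ∈ I} be a family of additive maps T_i : M[1/p] → N[1/p] such that: (a) each T_i is bounded, i.e. for each i ∈ I there exists k_i ≥ 0 with p^{k_i}·T_i(x) ∈ N for all x ∈ M; and (b) the family is pointwise bounded, i.e. for each x ∈ M[1/p] there exists k(x) ≥ 0 such that p^{k(x)}·T_i(x) ∈ N for all i ∈ I. Then the family is uniformly bounded: there exists k ≥ 0 such that p^k·T_i(x) ∈ N for all i ∈ I and all x ∈ M. -/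
/-- **Gliding hump.** Over a module that is precomplete for the topology of a principal ideal `(c)`,
a pointwise bounded family of bounded linear maps is uniformly bounded, where boundedness means
landing in the submodule `L` after multiplication by a power of `c`. -/
theorem exists_forall_pow_smul_mem_of_pointwise {R M V I : Type*} [CommRing R]
    [AddCommGroup M] [Module R M] [AddCommGroup V] [Module R V] (c : R)
    [IsPrecomplete (Ideal.span {c}) M] (L : Submodule R V) (S : I → M →ₗ[R] V)
    (hbd : ∀ i, ∃ k : ℕ, ∀ x, c ^ k • S i x ∈ L)
    (hpt : ∀ x, ∃ k : ℕ, ∀ i, c ^ k • S i x ∈ L) :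
    ∃ k : ℕ, ∀ i x, c ^ k • S i x ∈ L := by
  by_contra! hunif
  -- Any ball contains a smaller ball on which `c ^ k • S i` avoids `L` for some `i`.
  have hstep : ∀ (k : ℕ) (s : M × ℕ), ∃ t : M × ℕ, s.2 < t.2 ∧ (∃ y, t.1 = s.1 + c ^ s.2 • y) ∧
      ∃ i, ∀ y, c ^ k • S i (t.1 + c ^ t.2 • y) ∉ L := by
    rintro k ⟨x, a⟩
    obtain ⟨i, y, hy⟩ := hunif (k + a)
    obtain ⟨b, hb⟩ := hbd i
    have hcentre : ∃ y', c ^ k • S i (x + c ^ a • y') ∉ L := by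
      by_contra! h
      refine hy ?_
      simpa [smul_smul, pow_add] using L.sub_mem (h y) (h 0)
    obtain ⟨y', hy'⟩ := hcentre
    refine ⟨(x + c ^ a • y', a + 1 + b), by dsimp only; omega, ⟨y', rfl⟩, i, fun z hz => hy' ?_⟩
    have hsmall : c ^ k • S i (c ^ (a + 1 + b) • z) ∈ L := by
      rw [map_smul, pow_add, mul_smul]
      exact L.smul_mem _ (L.smul_mem _ (hb z))
    simpa only [map_add, smul_add, add_sub_cancel_right] using L.sub_mem hz hsmall
  choose step hlt hnear havoid using hstep
  let s : ℕ → M × ℕ := fun n => Nat.rec (0, 0) step n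
  have hmono : StrictMono fun n => (s n).2 := strictMono_nat_of_lt_succ fun n => hlt n (s n)
  have hcauchy : ∀ m d, ∃ y, (s (m + d)).1 = (s m).1 + c ^ (s m).2 • y := by
    intro m d
    induction d with
    | zero => exact ⟨0, by simp⟩
    | succ d ih =>
      obtain ⟨y, hy⟩ := ih
      obtain ⟨z, hz⟩ := hnear (m + d) (s (m + d))
      obtain ⟨e, he⟩ := Nat.exists_eq_add_of_le (hmono.monotone (Nat.le_add_right m d))
      refine ⟨y + c ^ e • z, ?_⟩
      change (step (m + d) (s (m + d))).1 = _
      rw [hz, he, hy, smul_add, smul_smul, pow_add, add_assoc]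
  have hmem : ∀ n (v : M),
      v ∈ (Ideal.span {c} ^ n • ⊤ : Submodule R M) ↔ ∃ y, v = c ^ n • y := by
    intro n v
    rw [Ideal.span_singleton_pow, Submodule.ideal_span_singleton_smul,
      Submodule.mem_smul_pointwise_iff_exists]
    simp [eq_comm]
  obtain ⟨x, hx⟩ := IsPrecomplete.prec (I := Ideal.span {c}) inferInstance
    (f := fun n => (s n).1) (by
      intro m n hmn
      obtain ⟨d, rfl⟩ := Nat.exists_eq_add_of_le hmn
      obtain ⟨y, hy⟩ := hcauchy m d
      obtain ⟨e, he⟩ := Nat.exists_eq_add_of_le (hmono.id_le m)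
      simp only [id_eq] at he
      refine (SModEq.sub_mem.2 ((hmem _ _).2 ⟨c ^ e • y, ?_⟩)).symm
      rw [hy, add_sub_cancel_left, he, pow_add, mul_smul])
  have hlim : ∀ m, ∃ y, x = (s m).1 + c ^ (s m).2 • y := by
    intro m
    obtain ⟨d, hd⟩ := Nat.exists_eq_add_of_le (hmono.id_le m)
    simp only [id] at hd
    obtain ⟨y, hy⟩ := hcauchy m d
    obtain ⟨z, hz⟩ := (hmem _ _).1 (SModEq.sub_mem.1 (hx (s m).2).symm)
    rw [← hd] at hy
    refine ⟨y + z, ?_⟩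
    rw [smul_add, ← add_assoc, ← hy, ← hz]
    abel
  obtain ⟨k, hk⟩ := hpt x
  obtain ⟨i, hi⟩ := havoid k (s k)
  obtain ⟨y, hy⟩ := hlim (k + 1)
  exact hi y (hy ▸ hk i)

/-- **uniform boundedness for adic modules.**
Let `M, N` be `p`-torsion-free, `p`-adically complete abelian groups and
`(T_i)_{i ∈ I}` a family of additive maps `M[1/p] → N[1/p]` such that each `T_i` is
bounded and the family is pointwise bounded.  Then the family is uniformly bounded:
there is `k ≥ 0` with `p^k • T_i(x) ∈ N` for all `i` and all `x ∈ M`. -/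
theorem uniform_boundedness_adic
    (p : ℕ) (hp : p.Prime)
    (M N : Type*) [AddCommGroup M] [AddCommGroup N]
    (htfM : ∀ m : M, (p : ℤ) • m = 0 → m = 0)
    (htfN : ∀ n : N, (p : ℤ) • n = 0 → n = 0)
    [IsAdicComplete (Ideal.span {(p : ℤ)}) M]
    [IsAdicComplete (Ideal.span {(p : ℤ)}) N]
    (I : Type*)
    (T : I → (LocalizedModule (Submonoid.powers (p : ℤ)) M →+
              LocalizedModule (Submonoid.powers (p : ℤ)) N))
    (hbd : ∀ i : I, ∃ k : ℕ, ∀ x : M, ∃ n : N,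
      ((p : ℤ) ^ k) • T i (LocalizedModule.mkLinearMap (Submonoid.powers (p : ℤ)) M x) =
        LocalizedModule.mkLinearMap (Submonoid.powers (p : ℤ)) N n)
    (hpt : ∀ x : LocalizedModule (Submonoid.powers (p : ℤ)) M, ∃ k : ℕ, ∀ i : I, ∃ n : N,
      ((p : ℤ) ^ k) • T i x =
        LocalizedModule.mkLinearMap (Submonoid.powers (p : ℤ)) N n) :
    ∃ k : ℕ, ∀ i : I, ∀ x : M, ∃ n : N,
      ((p : ℤ) ^ k) • T i (LocalizedModule.mkLinearMap (Submonoid.powers (p : ℤ)) M x) =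
        LocalizedModule.mkLinearMap (Submonoid.powers (p : ℤ)) N n := by
  let L := AddSubgroup.toIntSubmodule
    (LocalizedModule.mkLinearMap (Submonoid.powers (p : ℤ)) N).toAddMonoidHom.range
  let S : I → M →ₗ[ℤ] LocalizedModule (Submonoid.powers (p : ℤ)) N := fun i =>
    { toFun := fun x => T i (LocalizedModule.mkLinearMap (Submonoid.powers (p : ℤ)) M x)
      map_add' := fun x y => by simp only [map_add]
      map_smul' := fun r x => by simp }
  have mem_L (v) : v ∈ L ↔
      ∃ n, v = LocalizedModule.mkLinearMap (Submonoid.powers (p : ℤ)) N n :=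
    exists_congr fun _ => eq_comm
  obtain ⟨k, hk⟩ := exists_forall_pow_smul_mem_of_pointwise (p : ℤ) L S
    (fun i => (hbd i).imp fun k h x => (mem_L _).2 (h x))
    (fun x => (hpt _).imp fun k h i => (mem_L _).2 (h i))
  exact ⟨k, fun i x => (mem_L _).1 (hk i x)⟩
end

section
/- Let p be a prime and A a commutative ring which is p-adically complete and p-torsion-free, and let M and N be p-adically complete, p-torsion-free A-modules. Assume that M[1/p] is a finitely generated A[1/p]-module. Then every A-linear map f : M[1/p] → N[1/p] is automatically bounded (equivalently, continuous for the p-adic topologies): there exists k ≥ 0 such that p^k·f(x) ∈ N for all x ∈ M. -/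
/-- Over a principal ideal `(r)`, precompleteness yields limits of `r`-adic Cauchy sequences. -/
theorem IsPrecomplete.exists_eq_add_pow_smul {A M : Type*} [CommRing A] [AddCommGroup M]
    [Module A M] (r : A) [IsPrecomplete (Ideal.span {r}) M] (s : ℕ → M)
    (hs : ∀ m, ∃ c, s (m + 1) = s m + r ^ m • c) :
    ∃ L, ∀ m, ∃ c, L = s m + r ^ m • c := by
  have key (m : ℕ) (x y : M) :
      x ≡ y [SMOD (Ideal.span {r} ^ m • ⊤ : Submodule A M)] ↔ ∃ c, x = y + r ^ m • c := by
    rw [SModEq.sub_mem, Ideal.span_singleton_pow, Submodule.ideal_span_singleton_smul,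
      Submodule.mem_smul_pointwise_iff_exists]
    refine exists_congr fun c => ?_
    rw [eq_sub_iff_add_eq']
    simp [eq_comm]
  have hcauchy {m n : ℕ} (hmn : m ≤ n) :
      s m ≡ s n [SMOD (Ideal.span {r} ^ m • ⊤ : Submodule A M)] := by
    refine ((key m _ _).2 ?_).symm
    induction n, hmn using Nat.le_induction with
    | base => exact ⟨0, by simp⟩
    | succ n hmn ih =>
      obtain ⟨c, hc⟩ := ih
      obtain ⟨d, hd⟩ := hs n
      refine ⟨c + r ^ (n - m) • d, ?_⟩
      rw [hd, hc, smul_add, smul_smul, ← pow_add, Nat.add_sub_cancel' hmn, add_assoc]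
  obtain ⟨L, hL⟩ := IsPrecomplete.prec ‹_› hcauchy
  exact ⟨L, fun m => (key m _ _).1 (hL m).symm⟩

/-- A Baire category argument: if `M` is `r`-adically precomplete and every element of `M` is
carried into the submodule `P` by a power of `r`, then `P` is dense in a neighbourhood of `0`,
at least up to the next order. -/
theorem Submodule.exists_pow_smul_mem_add_pow_succ_smul {A M : Type*} [CommRing A]
    [AddCommGroup M] [Module A M] (r : A) [IsPrecomplete (Ideal.span {r}) M]
    (P : Submodule A M) (hP : ∀ x, ∃ k : ℕ, r ^ k • x ∈ P) :
    ∃ c : ℕ, ∀ x, ∃ z ∈ P, ∃ y, r ^ c • x = z + r ^ (c + 1) • y := by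
  by_contra! hcon
  have step (k n : ℕ) (x : M) : ∃ x' y, x' = x + r ^ n • y ∧
      ∀ z ∈ P, ∀ w, r ^ k • x' ≠ z + r ^ (n + k + 1) • w := by
    by_cases h : ∀ z ∈ P, ∀ w, r ^ k • x ≠ z + r ^ (n + k + 1) • w
    · exact ⟨x, 0, by simp, h⟩
    push Not at h
    obtain ⟨z, hz, w, hw⟩ := h
    obtain ⟨y, hy⟩ := hcon (n + k)
    refine ⟨_, y, rfl, fun z' hz' w' h' => hy (z' - z) (P.sub_mem hz' hz) (w' - w) ?_⟩
    rw [smul_add, hw, smul_smul, ← pow_add, add_comm k n] at h'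
    rw [smul_sub, ← sub_eq_zero]
    rw [← sub_eq_zero] at h'
    rw [← h']
    abel
  choose g δ hg hg' using step
  let e : ℕ → ℕ := fun k => k.rec 0 fun k n => n + k + 1
  have he (k) : e (k + 1) = e k + k + 1 := rfl
  let s : ℕ → M := fun k => k.rec 0 fun k x => g k (e k) x
  have hs (k) : s (k + 1) = g k (e k) (s k) := rfl
  have hmono : StrictMono e := strictMono_nat_of_lt_succ fun k => by rw [he]; omega
  have hstep (m n : ℕ) (hmn : m ≤ n) : ∃ c, s n = s m + r ^ e m • c := by
    induction n, hmn using Nat.le_induction with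
    | base => exact ⟨0, by simp⟩
    | succ n hmn ih =>
      obtain ⟨c, hc⟩ := ih
      refine ⟨c + r ^ (e n - e m) • δ n (e n) (s n), ?_⟩
      rw [hs, hg, smul_add, smul_smul, ← pow_add,
        Nat.add_sub_cancel' (hmono.monotone hmn), ← add_assoc, ← hc]
  obtain ⟨L, hL⟩ := IsPrecomplete.exists_eq_add_pow_smul r s fun m => by
    obtain ⟨c, hc⟩ := hstep m (m + 1) m.le_succ
    refine ⟨r ^ (e m - m) • c, ?_⟩
    rw [smul_smul, ← pow_add, Nat.add_sub_cancel' hmono.le_apply, hc]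
  obtain ⟨k, hk⟩ := hP L
  obtain ⟨c, hc⟩ := hL (e (k + 1))
  obtain ⟨d, hd⟩ := hstep (k + 1) (e (k + 1)) hmono.le_apply
  refine hg' k (e k) (s k) _ hk (-(r ^ k • (d + c))) ?_
  rw [← hs, hc, hd, ← he]
  simp only [smul_add, smul_neg, smul_smul, mul_comm (r ^ k)]
  abel

/-- If `A` is `r`-adically precomplete and `M` is `r`-adically complete, then a finitely generated
submodule of `M` whose saturation is `M` contains `r ^ c • M` for some `c`. -/
theorem Submodule.exists_pow_smul_mem_of_span_range {A M ι : Type*} [CommRing A] [AddCommGroup M]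
    [Module A M] [Finite ι] (r : A) [IsPrecomplete (Ideal.span {r}) A]
    [IsAdicComplete (Ideal.span {r}) M] (v : ι → M)
    (hv : ∀ x, ∃ k : ℕ, r ^ k • x ∈ span A (Set.range v)) :
    ∃ c : ℕ, ∀ x, r ^ c • x ∈ span A (Set.range v) := by
  have := Fintype.ofFinite ι
  obtain ⟨c, hc⟩ := exists_pow_smul_mem_add_pow_succ_smul r _ hv
  refine ⟨c, fun x => ?_⟩
  have hc' (x) : ∃ (a : ι → A) (y : M), r ^ c • x = ∑ i, a i • v i + r ^ (c + 1) • y := by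
    obtain ⟨z, hz, y, h⟩ := hc x
    obtain ⟨a, rfl⟩ := (mem_span_range_iff_exists_fun A).1 hz
    exact ⟨a, y, h⟩
  choose a y hay using hc'
  let w : ℕ → M := fun n => y^[n] x
  have hw (n) : w (n + 1) = y (w n) := Function.iterate_succ_apply' y n x
  let t : ℕ → ι → A := fun n i => ∑ j ∈ Finset.range n, r ^ j * a (w j) i
  have ht (n) : r ^ c • x = ∑ i, t n i • v i + r ^ (c + n) • w n := by
    induction n with
    | zero => simp [t, w]
    | succ n ih =>
      have h1 : r ^ (c + n) • w n =
          ∑ i, (r ^ n * a (w n) i) • v i + r ^ (c + (n + 1)) • w (n + 1) := by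
        rw [add_comm c n, pow_add, mul_smul, hay, hw, smul_add, Finset.smul_sum, smul_smul,
          ← pow_add]
        simp only [mul_smul]
        congr 3
        omega
      rw [ih, h1, ← add_assoc, ← Finset.sum_add_distrib]
      simp only [t, Finset.sum_range_succ, add_smul]
  have hlim (i) : ∃ L : A, ∀ m, ∃ d, L = t m i + r ^ m • d :=
    IsPrecomplete.exists_eq_add_pow_smul r (fun m => t m i) fun m =>
      ⟨a (w m) i, by simp [t, Finset.sum_range_succ]⟩
  choose L d hd using hlim
  refine (mem_span_range_iff_exists_fun A).2 ⟨L, ?_⟩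
  rw [← sub_eq_zero]
  refine IsHausdorff.haus (I := Ideal.span {r}) inferInstance _ fun n => ?_
  rw [SModEq.zero, Ideal.span_singleton_pow, ideal_span_singleton_smul,
    mem_smul_pointwise_iff_exists]
  refine ⟨∑ i, d i n • v i - r ^ c • w n, trivial, ?_⟩
  have hL : ∑ i, L i • v i = ∑ i, t n i • v i + r ^ n • ∑ i, d i n • v i := by
    rw [Finset.smul_sum, ← Finset.sum_add_distrib]
    refine Finset.sum_congr rfl fun i _ => ?_
    rw [hd i n, add_smul, smul_assoc]
  rw [hL, ht n, smul_sub, smul_smul, ← pow_add, add_comm n c]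
  abel

/-- If `M[1/r]` is finitely generated over `A[1/r]`, then finitely many elements of `M`
generate a submodule whose `r`-power saturation is `M`. -/
theorem LocalizedModule.exists_pow_smul_mem_span_range {A : Type*} (M : Type*) [CommRing A]
    [AddCommGroup M] [Module A M] (r : A)
    [Module.Finite (Localization.Away r) (LocalizedModule (Submonoid.powers r) M)] :
    ∃ (n : ℕ) (v : Fin n → M), ∀ x, ∃ k : ℕ, r ^ k • x ∈ Submodule.span A (Set.range v) := by
  set S := Submonoid.powers r
  obtain ⟨n, g, hg⟩ := Module.Finite.exists_fin (R := Localization.Away r)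
    (M := LocalizedModule S M)
  choose v hv using fun i => IsLocalizedModule.surj S (mkLinearMap S M) (g i)
  refine ⟨n, fun i => (v i).1, fun x => ?_⟩
  set P := Submodule.span A (Set.range fun i => (v i).1)
  have key (y : LocalizedModule S M) : ∃ s : S, ∃ z ∈ P, s • y = mkLinearMap S M z := by
    have hy : y ∈ Submodule.span (Localization.Away r) (Set.range g) := hg ▸ trivial
    induction hy using Submodule.span_induction with
    | mem y hy =>
      obtain ⟨i, rfl⟩ := hy
      exact ⟨(v i).2, _, Submodule.subset_span ⟨i, rfl⟩, hv i⟩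
    | zero => exact ⟨1, 0, P.zero_mem, by simp⟩
    | add y y' _ _ h h' =>
      obtain ⟨s, z, hz, h⟩ := h
      obtain ⟨s', z', hz', h'⟩ := h'
      refine ⟨s * s', s' • z + s • z', P.add_mem (P.smul_mem _ hz) (P.smul_mem _ hz'), ?_⟩
      rw [map_add, smul_add, mul_smul, mul_smul, smul_comm s s' y, h, h']
      simp [Submonoid.smul_def]
    | smul a y _ h =>
      obtain ⟨s, z, hz, h⟩ := h
      obtain ⟨⟨b, t⟩, hb⟩ := IsLocalization.surj S a
      refine ⟨t * s, b • z, P.smul_mem _ hz, ?_⟩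
      have hta : (t : A) • a = algebraMap A (Localization.Away r) b := by
        rw [Algebra.smul_def, mul_comm, ← hb]
      rw [map_smul, ← h, mul_smul, Submonoid.smul_def, Submonoid.smul_def,
        smul_comm (s : A) a y, ← smul_assoc, hta, algebraMap_smul]
      rfl
  obtain ⟨s, z, hz, h⟩ := key (mkLinearMap S M x)
  rw [Submonoid.smul_def, ← map_smul] at h
  obtain ⟨t, ht⟩ := (IsLocalizedModule.eq_iff_exists S (mkLinearMap S M)).1 h
  obtain ⟨k, hk⟩ := (t * s).2
  refine ⟨k, ?_⟩
  have : r ^ k • x = t • z := by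
    rw [← ht, Submonoid.smul_def, smul_smul, ← Submonoid.coe_mul, ← hk]
  rw [this]
  exact P.smul_mem _ hz

/-- **automatic continuity.**
Let `A` be a `p`-adically complete, `p`-torsion-free commutative ring and `M, N`
`p`-adically complete, `p`-torsion-free `A`-modules with `M[1/p]` finitely generated
over `A[1/p]`.  Then every `A`-linear map `f : M[1/p] → N[1/p]` is bounded: there is
`k ≥ 0` with `p^k • f(x) ∈ N` for every `x ∈ M`. -/
theorem automatic_continuity_adic
    (p : ℕ) (hp : p.Prime) (A : Type*) [CommRing A]
    (htfA : ∀ a : A, (p : A) * a = 0 → a = 0)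
    [IsAdicComplete (Ideal.span {(p : A)}) A]
    (M N : Type*) [AddCommGroup M] [Module A M] [AddCommGroup N] [Module A N]
    (htfM : ∀ m : M, (p : A) • m = 0 → m = 0)
    (htfN : ∀ n : N, (p : A) • n = 0 → n = 0)
    [IsAdicComplete (Ideal.span {(p : A)}) M]
    [IsAdicComplete (Ideal.span {(p : A)}) N]
    [Module.Finite (Localization.Away (p : A))
      (LocalizedModule (Submonoid.powers (p : A)) M)]
    (f : LocalizedModule (Submonoid.powers (p : A)) M →ₗ[A]
         LocalizedModule (Submonoid.powers (p : A)) N) :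
    ∃ k : ℕ, ∀ x : M, ∃ n : N,
      ((p : A) ^ k) • f (LocalizedModule.mkLinearMap (Submonoid.powers (p : A)) M x) =
        LocalizedModule.mkLinearMap (Submonoid.powers (p : A)) N n := by
  obtain ⟨n, v, hv⟩ := LocalizedModule.exists_pow_smul_mem_span_range M (p : A)
  obtain ⟨c, hc⟩ := Submodule.exists_pow_smul_mem_of_span_range (p : A) v hv
  let S := Submonoid.powers (p : A)
  let ιM := LocalizedModule.mkLinearMap S M
  let ιN := LocalizedModule.mkLinearMap S N
  have hgen (i) : ∃ d : ℕ, (p : A) ^ d • f (ιM (v i)) ∈ LinearMap.range ιN := by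
    obtain ⟨⟨y, ⟨_, d, rfl⟩⟩, h⟩ := IsLocalizedModule.surj S ιN (f (ιM (v i)))
    exact ⟨d, y, h.symm⟩
  choose d hd using hgen
  let D := ∑ i, d i
  have hspan : Submodule.span A (Set.range v) ≤
      (LinearMap.range ιN).comap ((p : A) ^ D • (f ∘ₗ ιM)) := by
    rw [Submodule.span_le]
    rintro _ ⟨i, rfl⟩
    have hle : d i ≤ D := Finset.single_le_sum (fun _ _ => Nat.zero_le _) (Finset.mem_univ i)
    change (p : A) ^ D • f (ιM (v i)) ∈ LinearMap.range ιN
    rw [← Nat.sub_add_cancel hle, pow_add, mul_smul]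
    exact Submodule.smul_mem _ _ (hd i)
  refine ⟨D + c, fun x => ?_⟩
  obtain ⟨y, hy⟩ := hspan (hc x)
  refine ⟨y, ?_⟩
  change _ = ιN y
  rw [hy, map_smul, pow_add, mul_smul, smul_comm]
  rfl
end

section
/- Let p be a prime, A a p-adically complete commutative ring, and M a p-adically complete A-module such that for every n ≥ 1 the A/p^nA-module M/p^nM is finitely generated and projective. Then M is a finitely generated projective A-module. -/
open Submodule in
/-- A linear map out of `M` lifts along `g : X → Y` when `X` is killed by an ideal `J` for which
`M ⧸ J M` is projective over `A ⧸ J`. -/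
theorem Module.exists_comp_eq_of_projective_quotient {A M X Y : Type*} [CommRing A]
    [AddCommGroup M] [Module A M] [AddCommGroup X] [Module A X] [AddCommGroup Y] [Module A Y]
    (J : Ideal A) [Module.Projective (A ⧸ J) (M ⧸ (J • ⊤ : Submodule A M))]
    (hX : Module.IsTorsionBySet A X J) (g : X →ₗ[A] Y) (h : M →ₗ[A] Y)
    (hgh : LinearMap.range h ≤ LinearMap.range g) : ∃ l : M →ₗ[A] X, g ∘ₗ l = h := by
  have hY : Module.IsTorsionBySet A (LinearMap.range g) J := by
    rintro ⟨_, x, rfl⟩ a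
    ext
    exact (map_smul g (a : A) x).symm.trans (by rw [@hX x a, map_zero]; rfl)
  let := hX.module
  let := hY.module
  let h' : M →ₗ[A] LinearMap.range g := h.codRestrict _ fun m ↦ hgh ⟨m, rfl⟩
  let q : (M ⧸ (J • ⊤ : Submodule A M)) →ₗ[A] LinearMap.range g :=
    (J • ⊤ : Submodule A M).liftQ h' <| smul_le.2 fun a ha m _ ↦
      (map_smul h' a m).trans (@hY (h' m) ⟨a, ha⟩)
  have hsurj : Function.Surjective (algebraMap A (A ⧸ J)) := Ideal.Quotient.mk_surjective
  obtain ⟨l, hl⟩ := Module.projective_lifting_property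
    (g.rangeRestrict.extendScalarsOfSurjective hsurj) (q.extendScalarsOfSurjective hsurj)
    g.surjective_rangeRestrict
  refine ⟨l.restrictScalars A ∘ₗ mkQ _, LinearMap.ext fun m ↦ ?_⟩
  exact congrArg Subtype.val (LinearMap.congr_fun hl (Submodule.Quotient.mk m))

/-- A finite product of `I`-adically complete modules is `I`-adically complete. -/
theorem IsAdicComplete.pi {A ι : Type*} [CommRing A] [Finite ι] (I : Ideal A) (M : ι → Type*)
    [∀ i, AddCommGroup (M i)] [∀ i, Module A (M i)] [∀ i, IsAdicComplete I (M i)] :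
    IsAdicComplete I (∀ i, M i) := by
  classical
  cases nonempty_fintype ι
  rw [← AdicCompletion.of_bijective_iff,
    ← (AdicCompletion.piEquivOfFintype I M).bijective.of_comp_iff']
  convert Function.Bijective.piMap fun i ↦ AdicCompletion.of_bijective I (M i) using 1
  ext x i n
  simp [AdicCompletion.pi]

open Submodule in
/-- If `π : F → M` is surjective and `M ⧸ Iⁿ⁺¹ M` is projective over `A ⧸ Iⁿ⁺¹`, then a section
of `π` modulo `Iⁿ` lifts to a section of `π` modulo `Iⁿ⁺¹`. -/
theorem Module.exists_section_mod_pow_succ {A F M : Type*} [CommRing A]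
    [AddCommGroup F] [Module A F] [AddCommGroup M] [Module A M] (I : Ideal A) (n : ℕ)
    [Module.Projective (A ⧸ I ^ (n + 1)) (M ⧸ (I ^ (n + 1) • ⊤ : Submodule A M))]
    {π : F →ₗ[A] M} (hπ : Function.Surjective π)
    (s : M →ₗ[A] F ⧸ (I ^ n • ⊤ : Submodule A F))
    (hs : mapQ _ _ π (smul_top_le_comap_smul_top (I ^ n) π) ∘ₗ s = mkQ _) :
    ∃ t : M →ₗ[A] F ⧸ (I ^ (n + 1) • ⊤ : Submodule A F),
      factorPow I F n.le_succ ∘ₗ t = s ∧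
        mapQ _ _ π (smul_top_le_comap_smul_top (I ^ (n + 1)) π) ∘ₗ t = mkQ _ := by
  let g := (factorPow I F n.le_succ).prod (mapQ _ _ π (smul_top_le_comap_smul_top (I ^ (n + 1)) π))
  let h := s.prod (mkQ (I ^ (n + 1) • ⊤ : Submodule A M))
  have hgh : LinearMap.range h ≤ LinearMap.range g := by
    rintro _ ⟨m, rfl⟩
    obtain ⟨x, hx⟩ := mkQ_surjective _ (s m)
    have hmem : m - π x ∈ (I ^ n • ⊤ : Submodule A F).map π := by
      rw [map_smul'', Submodule.map_top, LinearMap.range_eq_top.2 hπ,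
        ← Submodule.Quotient.mk_eq_zero, Submodule.Quotient.mk_sub, sub_eq_zero]
      have hm := LinearMap.congr_fun hs m
      rw [LinearMap.comp_apply, ← hx] at hm
      exact hm.symm
    obtain ⟨y, hy, hyx⟩ := hmem
    refine ⟨mkQ _ (x + y), Prod.ext ?_ ?_⟩
    · change mkQ (I ^ n • ⊤ : Submodule A F) (x + y) = s m
      rw [map_add, hx, add_eq_left]
      exact (Submodule.Quotient.mk_eq_zero _).2 hy
    · change mkQ (I ^ (n + 1) • ⊤ : Submodule A M) (π (x + y)) = mkQ _ m
      rw [map_add, hyx, add_sub_cancel]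
  obtain ⟨t, ht⟩ := exists_comp_eq_of_projective_quotient (I ^ (n + 1))
    (Module.isTorsionBySet_quotient_ideal_smul F (I ^ (n + 1))) g h hgh
  exact ⟨t, LinearMap.ext fun m ↦ congrArg Prod.fst (LinearMap.congr_fun ht m),
    LinearMap.ext fun m ↦ congrArg Prod.snd (LinearMap.congr_fun ht m)⟩

open Submodule in
/-- A surjection from an `I`-adically complete module `F` onto an `I`-adically separated module
`M` splits if all the `M ⧸ Iⁿ⁺¹ M` are projective over `A ⧸ Iⁿ⁺¹`. -/
theorem Module.exists_section_of_isAdicComplete {A F M : Type*} [CommRing A]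
    [AddCommGroup F] [Module A F] [AddCommGroup M] [Module A M] (I : Ideal A)
    [IsAdicComplete I F] [IsHausdorff I M]
    (hproj : ∀ n, Module.Projective (A ⧸ I ^ (n + 1)) (M ⧸ (I ^ (n + 1) • ⊤ : Submodule A M)))
    {π : F →ₗ[A] M} (hπ : Function.Surjective π) :
    ∃ s : M →ₗ[A] F, π ∘ₗ s = LinearMap.id := by
  choose! next hnext hnext' using fun n ↦
    exists_section_mod_pow_succ (F := F) (π := π) I n hπ
  have : Subsingleton (M ⧸ (I ^ 0 • ⊤ : Submodule A M)) := by
    rw [Submodule.Quotient.subsingleton_iff]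
    simp
  let s (n : ℕ) : M →ₗ[A] F ⧸ (I ^ n • ⊤ : Submodule A F) := Nat.rec 0 next n
  have hs (n : ℕ) : mapQ _ _ π (smul_top_le_comap_smul_top (I ^ n) π) ∘ₗ s n = mkQ _ := by
    induction n with
    | zero => exact LinearMap.ext fun m ↦ Subsingleton.elim _ _
    | succ n ih => exact hnext' n _ ih
  have hcompat {n : ℕ} : factorPow I F n.le_succ ∘ₗ s (n + 1) = s n := hnext n _ (hs n)
  let σ : M →ₗ[A] F := IsAdicComplete.StrictMono.lift I strictMono_id s hcompat
  refine ⟨σ, DFunLike.coe_injective <| IsHausdorff.funext I fun n m ↦ ?_⟩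
  have hσ : Submodule.Quotient.mk (σ m) = s n m :=
    IsAdicComplete.StrictMono.mk_lift I strictMono_id s hcompat m
  simpa [← hσ] using LinearMap.congr_fun (hs n) m

open Submodule in
/-- Over an `I`-adically complete ring, an `I`-adically separated module `M` with `M ⧸ I M` finite
and all `M ⧸ Iⁿ⁺¹ M` projective over `A ⧸ Iⁿ⁺¹` is finite projective. -/
theorem Module.finite_and_projective_of_isAdicComplete {A M : Type*} [CommRing A]
    [AddCommGroup M] [Module A M] (I : Ideal A) [IsAdicComplete I A] [IsHausdorff I M]
    [Module.Finite (A ⧸ I) (M ⧸ (I • ⊤ : Submodule A M))]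
    (hproj : ∀ n, Module.Projective (A ⧸ I ^ (n + 1)) (M ⧸ (I ^ (n + 1) • ⊤ : Submodule A M))) :
    Module.Finite A M ∧ Module.Projective A M := by
  have : Module.Finite A (M ⧸ (I • ⊤ : Submodule A M)) := Module.Finite.trans (A ⧸ I) _
  obtain ⟨k, f, hf⟩ := Module.Finite.exists_fin' A (M ⧸ (I • ⊤ : Submodule A M))
  obtain ⟨π, hπf⟩ := Module.projective_lifting_property (mkQ (I • ⊤ : Submodule A M)) f
    (mkQ_surjective _)
  have : IsAdicComplete I (Fin k → A) := .pi I _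
  have hπ : Function.Surjective π := surjective_of_mkQ_comp_surjective (I := I) (hπf ▸ hf)
  obtain ⟨s, hs⟩ := exists_section_of_isAdicComplete I hproj hπ
  exact ⟨.of_surjective π hπ, .of_split s π hs⟩

/-- Let `A` be a `p`-adically complete commutative ring and `M` a
`p`-adically complete `A`-module such that for every `n ≥ 1` the `A/pⁿA`-module
`M/pⁿM` is finitely generated and projective.  Then `M` is a finitely generated
projective `A`-module. -/
theorem finite_projective_of_complete_mod_p
    (p : ℕ) (hp : p.Prime) (A : Type*) [CommRing A]
    [IsAdicComplete (Ideal.span {(p : A)}) A]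
    (M : Type*) [AddCommGroup M] [Module A M]
    [IsAdicComplete (Ideal.span {(p : A)}) M]
    (hfin : ∀ n : ℕ, 1 ≤ n →
      Module.Finite (A ⧸ Ideal.span {(p : A) ^ n})
        (M ⧸ (Ideal.span {(p : A) ^ n} • ⊤ : Submodule A M)))
    (hproj : ∀ n : ℕ, 1 ≤ n →
      Module.Projective (A ⧸ Ideal.span {(p : A) ^ n})
        (M ⧸ (Ideal.span {(p : A) ^ n} • ⊤ : Submodule A M))) :
    Module.Finite A M ∧ Module.Projective A M := by
  have hfin₁ := hfin 1 le_rfl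
  rw [pow_one] at hfin₁
  refine Module.finite_and_projective_of_isAdicComplete (Ideal.span {(p : A)}) fun n ↦ ?_
  have hproj_succ := hproj (n + 1) n.succ_pos
  rwa [← Ideal.span_singleton_pow] at hproj_succ
end

section
/- Let p be a prime, R a p-adically complete, p-torsion-free commutative ring, and N a p-adically complete, p-torsion-free R-module such that N[1/p] is a finitely generated projective R[1/p]-module. Then there exist an integer k ≥ 0, a finite free R-module F, and R-linear maps s : N → F and q : F → N such that q ∘ s = p^k · id_N. -/
namespace AdicSplitting

variable {R : Type*} [CommRing R] {M : Type*} [AddCommGroup M] [Module R M]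

lemma mem_span_singleton_pow_smul_top_iff (a : R) (n : ℕ) (x : M) :
    x ∈ (Ideal.span {a} ^ n • ⊤ : Submodule R M) ↔ ∃ y : M, x = a ^ n • y := by
  rw [Ideal.span_singleton_pow, Submodule.ideal_span_singleton_smul]
  constructor
  · rintro ⟨y, -, rfl⟩
    exact ⟨y, rfl⟩
  · rintro ⟨y, rfl⟩
    exact ⟨y, trivial, rfl⟩

/-- In an `a`-adically precomplete module, a sequence whose `n`-th increment is divisible by `a ^ n`
has a limit. -/
lemma exists_limit_of_succ (a : R) [IsPrecomplete (Ideal.span {a}) M] (f : ℕ → M)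
    (hf : ∀ n, ∃ y, f (n + 1) = f n + a ^ n • y) :
    ∃ L : M, ∀ n, ∃ y, L = f n + a ^ n • y := by
  have cauchy : ∀ {m n}, m ≤ n → f m ≡ f n [SMOD (Ideal.span {a} ^ m • ⊤ : Submodule R M)] := by
    intro m n hmn
    induction n, hmn using Nat.le_induction with
    | base => rfl
    | succ n hmn ih =>
      refine ih.trans (SModEq.symm (SModEq.sub_mem.2 ?_))
      obtain ⟨y, hy⟩ := hf n
      refine (mem_span_singleton_pow_smul_top_iff a m _).2 ⟨a ^ (n - m) • y, ?_⟩
      rw [hy, smul_smul, ← pow_add, Nat.add_sub_cancel' hmn, add_sub_cancel_left]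
  obtain ⟨L, hL⟩ := IsPrecomplete.prec ‹_› cauchy
  refine ⟨L, fun n => ?_⟩
  obtain ⟨y, hy⟩ := (mem_span_singleton_pow_smul_top_iff a n _).1 (SModEq.sub_mem.1 (hL n).symm)
  exact ⟨y, by rw [← hy, add_sub_cancel]⟩

lemma eq_zero_of_forall_pow_smul (a : R) [IsHausdorff (Ideal.span {a}) M] (x : M)
    (hx : ∀ n, ∃ y, x = a ^ n • y) : x = 0 :=
  IsHausdorff.haus ‹_› x fun n => SModEq.sub_mem.2 <| by
    simpa using (mem_span_singleton_pow_smul_top_iff a n x).2 (hx n)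

/-- A Baire category argument: if every element of an `a`-adically precomplete module is
multiplied into `L` by a power of `a`, then `a ^ c • M` lies in `L` to first order for some `c`. -/
lemma exists_pow_smul_mem_add (a : R) [IsPrecomplete (Ideal.span {a}) M] (L : Submodule R M)
    (hL : ∀ x : M, ∃ k, a ^ k • x ∈ L) :
    ∃ c, ∀ x : M, ∃ l ∈ L, ∃ y, a ^ c • x = l + a ^ (c + 1) • y := by
  by_contra! h
  choose x hx using h
  have step (k : ℕ) (y : M) : ∃ z, (∃ w, z = y + a ^ k • w) ∧
      ∀ l ∈ L, ∀ w, a ^ k • z ≠ l + a ^ (2 * k + 1) • w := by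
    by_cases hy : ∀ l ∈ L, ∀ w, a ^ k • y ≠ l + a ^ (2 * k + 1) • w
    · exact ⟨y, ⟨0, by simp⟩, hy⟩
    · push Not at hy
      obtain ⟨l, hl, w, hw⟩ := hy
      refine ⟨y + a ^ k • x (2 * k), ⟨_, rfl⟩, fun l' hl' w' hw' => ?_⟩
      refine hx (2 * k) (l' - l) (L.sub_mem hl' hl) (w' - w) ?_
      rw [smul_add, hw, smul_smul, ← pow_add, ← two_mul] at hw'
      rw [smul_sub, ← sub_eq_zero]
      rw [← sub_eq_zero] at hw'
      rw [← hw']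
      abel
  choose z hz hzL using step
  let y : ℕ → M := fun n => Nat.rec 0 (fun k y => z k y) n
  obtain ⟨t, ht⟩ := exists_limit_of_succ a y fun n => hz n (y n)
  obtain ⟨k, hk⟩ := hL t
  obtain ⟨w, hw⟩ := ht (k + 1)
  refine hzL k (y k) _ hk (-w) ?_
  change a ^ k • y (k + 1) = _
  rw [hw, smul_add, smul_smul, ← pow_add, smul_neg, two_mul, add_assoc k k 1]
  abel

/-- Successive approximation: a map from a finite free module over an `a`-adically complete ring
that hits `a ^ c • M` to first order hits all of it. -/
lemma exists_eq_of_approx (a : R) [IsPrecomplete (Ideal.span {a}) R]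
    [IsHausdorff (Ideal.span {a}) M] {ι : Type*} (q : (ι → R) →ₗ[R] M) (c : ℕ)
    (h : ∀ x : M, ∃ f y, a ^ c • x = q f + a ^ (c + 1) • y) (x : M) :
    ∃ f, a ^ c • x = q f := by
  choose f y hfy using h
  let u : ℕ → M := fun n => y^[n] x
  have u_succ (n : ℕ) : u (n + 1) = y (u n) := Function.iterate_succ_apply' _ _ _
  let F : ℕ → ι → R := fun n => ∑ i ∈ Finset.range n, a ^ i • f (u i)
  have hF (n : ℕ) : a ^ c • x = q (F n) + a ^ n • a ^ c • u n := by
    induction n with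
    | zero => simp [F, u]
    | succ n ih =>
      rw [ih, hfy (u n), u_succ]
      simp only [F, Finset.sum_range_succ, map_add, map_smul, smul_add, smul_smul, ← pow_add]
      rw [add_assoc, show n + (c + 1) = n + 1 + c by ring]
  have lim (i : ι) : ∃ g : R, ∀ n, ∃ r, g = F n i + a ^ n • r :=
    exists_limit_of_succ a (fun n => F n i) fun n =>
      ⟨f (u n) i, by simp [F, Finset.sum_range_succ]⟩
  choose g r hr using lim
  refine ⟨g, sub_eq_zero.1 (eq_zero_of_forall_pow_smul a _ fun n => ?_)⟩
  have hg : g = F n + a ^ n • fun i => r i n := funext fun i => hr i n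
  refine ⟨a ^ c • u n - q fun i => r i n, ?_⟩
  rw [hF n, hg, map_add, map_smul, smul_sub]
  abel

/-- A linear map factors through any injective linear map whose range contains its own. -/
lemma exists_comp_eq_of_range_le {P Q : Type*} [AddCommGroup P] [Module R P]
    [AddCommGroup Q] [Module R Q] (i : P →ₗ[R] Q) (hi : Function.Injective i) (g : M →ₗ[R] Q)
    (hg : ∀ x, ∃ y, g x = i y) : ∃ s : M →ₗ[R] P, ∀ x, i (s x) = g x := by
  refine ⟨(LinearEquiv.ofInjective i hi).symm.toLinearMap ∘ₗ
    g.codRestrict (LinearMap.range i) fun x => ?_, fun x => ?_⟩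
  · obtain ⟨y, hy⟩ := hg x
    exact ⟨y, hy.symm⟩
  · have := LinearEquiv.apply_symm_apply (LinearEquiv.ofInjective i hi)
      (g.codRestrict (LinearMap.range i)
        (fun x => by obtain ⟨y, hy⟩ := hg x; exact ⟨y, hy.symm⟩) x)
    exact congrArg Subtype.val this

/-- A finite localized module is spanned by the images of finitely many elements. -/
lemma exists_span_range_eq_top (S : Submonoid R) (A : Type*) [CommRing A] [Algebra R A]
    [IsLocalization S A] {M' : Type*} [AddCommGroup M'] [Module R M'] [Module A M']
    [IsScalarTower R A M'] (f : M →ₗ[R] M') [IsLocalizedModule S f] [Module.Finite A M'] :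
    ∃ (m : ℕ) (e : Fin m → M), Submodule.span A (Set.range fun i => f (e i)) = ⊤ := by
  obtain ⟨m, v, hv⟩ := Module.Finite.exists_fin (R := A) (M := M')
  choose t ht using fun i => IsLocalizedModule.surj S f (v i)
  refine ⟨m, fun i => (t i).1, top_unique (hv ▸ Submodule.span_le.2 ?_)⟩
  rintro _ ⟨i, rfl⟩
  obtain ⟨b, hb⟩ := (IsLocalization.map_units A (t i).2).exists_left_inv
  have : v i = b • f (t i).1 := by
    rw [← ht i, Submonoid.smul_def, ← algebraMap_smul A ((t i).2 : R) (v i), smul_smul, hb,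
      one_smul]
  rw [this]
  exact Submodule.smul_mem _ _ (Submodule.subset_span ⟨i, rfl⟩)

lemma eq_zero_of_pow_smul_eq_zero (a : R) (ha : ∀ x : M, a • x = 0 → x = 0) (n : ℕ) (x : M)
    (hx : a ^ n • x = 0) : x = 0 := by
  induction n with
  | zero => simpa using hx
  | succ n ih => exact ih (ha _ (by rwa [smul_smul, ← pow_succ']))

lemma localization_injective (a : R) (ha : ∀ x : M, a • x = 0 → x = 0) {M' : Type*}
    [AddCommGroup M'] [Module R M'] (f : M →ₗ[R] M') [IsLocalizedModule (Submonoid.powers a) f] :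
    Function.Injective f := by
  refine (injective_iff_map_eq_zero f).2 fun x hx => ?_
  obtain ⟨⟨_, n, rfl⟩, hc⟩ := (IsLocalizedModule.eq_zero_iff (Submonoid.powers a) f).1 hx
  exact eq_zero_of_pow_smul_eq_zero a ha n x hc

/-- Clearing the denominators of a finite family in a localization away from `a`. -/
lemma exists_pow_smul_eq_algebraMap (a : R) (A : Type*) [CommRing A] [Algebra R A]
    [IsLocalization.Away a A] {ι : Type*} [Finite ι] (g : ι → A) :
    ∃ (k : ℕ) (r : ι → R), ∀ i, algebraMap R A (r i) = a ^ k • g i := by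
  obtain ⟨⟨_, k, rfl⟩, h⟩ := IsLocalization.exist_integer_multiples_of_finite (Submonoid.powers a) g
  choose r hr using h
  exact ⟨k, r, hr⟩

/-- The splitting up to a power of `a`, for any element `a` in place of a prime number. -/
theorem exists_splitting_up_to_pow (a : R) (htfR : ∀ x : R, a • x = 0 → x = 0)
    [IsPrecomplete (Ideal.span {a}) R] (htfM : ∀ x : M, a • x = 0 → x = 0)
    [IsAdicComplete (Ideal.span {a}) M]
    (A : Type*) [CommRing A] [Algebra R A] [IsLocalization.Away a A]
    {M' : Type*} [AddCommGroup M'] [Module R M'] [Module A M'] [IsScalarTower R A M']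
    (f : M →ₗ[R] M') [IsLocalizedModule (Submonoid.powers a) f]
    [Module.Finite A M'] [Module.Projective A M'] :
    ∃ (k m : ℕ) (s : M →ₗ[R] (Fin m → R)) (q : (Fin m → R) →ₗ[R] M),
      q ∘ₗ s = (a ^ k) • LinearMap.id := by
  obtain ⟨m, e, he⟩ := exists_span_range_eq_top (Submonoid.powers a) A f
  have hf : Function.Injective f := localization_injective a htfM f
  have hA : Function.Injective (algebraMap R A) := by
    have : IsLocalizedModule (Submonoid.powers a) (Algebra.linearMap R A) := inferInstance
    exact localization_injective a htfR (Algebra.linearMap R A)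
  let q : (Fin m → R) →ₗ[R] M := Fintype.linearCombination R e
  let Q : (Fin m → A) →ₗ[A] M' := Fintype.linearCombination A fun i => f (e i)
  have hQ : LinearMap.range Q = ⊤ := by rw [← he, Fintype.range_linearCombination]
  let i : (Fin m → R) →ₗ[R] (Fin m → A) := (Algebra.linearMap R A).compLeft (Fin m)
  have i_apply (g : Fin m → R) (j : Fin m) : i g j = algebraMap R A (g j) := rfl
  have hi : Function.Injective i := fun g h hgh => funext fun j => hA (congrFun hgh j)
  have Qi (g : Fin m → R) : Q (i g) = f (q g) := by
    simp [Q, q, Fintype.linearCombination_apply, i_apply]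
  obtain ⟨σ, hσ⟩ := Module.projective_lifting_property Q LinearMap.id (LinearMap.range_eq_top.1 hQ)
  have hσ' (x : M') : Q (σ x) = x := LinearMap.congr_fun hσ x
  have htors (x : M) : ∃ k, a ^ k • x ∈ LinearMap.range q := by
    obtain ⟨k, r, hr⟩ := exists_pow_smul_eq_algebraMap a A (σ (f x))
    refine ⟨k, r, hf ?_⟩
    have : i r = a ^ k • σ (f x) := funext hr
    rw [← Qi, this, LinearMap.map_smul_of_tower, hσ', map_smul]
  obtain ⟨c, hc⟩ := exists_pow_smul_mem_add a (LinearMap.range q) htors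
  have hq (x : M) : ∃ g, a ^ c • x = q g := by
    refine exists_eq_of_approx a q c (fun x => ?_) x
    obtain ⟨_, ⟨g, rfl⟩, y, hy⟩ := hc x
    exact ⟨g, y, hy⟩
  obtain ⟨k, r, hr⟩ := exists_pow_smul_eq_algebraMap a A
    fun t : Fin m × Fin m => σ (f (e t.1)) t.2
  let τ : M →ₗ[R] (Fin m → A) := a ^ (k + c) • (σ.restrictScalars R ∘ₗ f)
  have hτ (x : M) : τ x = a ^ (k + c) • σ (f x) := rfl
  obtain ⟨s, hs⟩ := exists_comp_eq_of_range_le i hi τ fun x => by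
    obtain ⟨g, hg⟩ := hq x
    refine ⟨∑ j, g j • fun l => r (j, l), ?_⟩
    have key (j : Fin m) : i (fun l => r (j, l)) = a ^ k • σ (f (e j)) :=
      funext fun l => hr (j, l)
    rw [hτ, pow_add, ← smul_smul, ← LinearMap.map_smul_of_tower σ, ← map_smul f, hg, map_sum]
    simp only [map_smul, key, q, Fintype.linearCombination_apply, map_sum,
      LinearMap.map_smul_of_tower σ, Finset.smul_sum]
    exact Finset.sum_congr rfl fun j _ => smul_comm _ _ _
  refine ⟨k + c, m, s, q, LinearMap.ext fun x => hf ?_⟩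
  rw [LinearMap.comp_apply, ← Qi, hs, hτ, LinearMap.map_smul_of_tower, hσ']
  simp

end AdicSplitting


/-- Let `R` be a `p`-adically complete, `p`-torsion-free commutative
ring and `N` a `p`-adically complete, `p`-torsion-free `R`-module such that `N[1/p]`
is finitely generated projective over `R[1/p]`.  Then there are `k ≥ 0`, a finite free
`R`-module `F = R^m`, and `R`-linear maps `s : N → F`, `q : F → N` with
`q ∘ s = p^k · id`. -/
theorem splitting_up_to_p_pow
    (p : ℕ) (hp : p.Prime) (R : Type*) [CommRing R]
    (htfR : ∀ a : R, (p : R) * a = 0 → a = 0)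
    [IsAdicComplete (Ideal.span {(p : R)}) R]
    (N : Type*) [AddCommGroup N] [Module R N]
    (htfN : ∀ x : N, (p : R) • x = 0 → x = 0)
    [IsAdicComplete (Ideal.span {(p : R)}) N]
    [Module.Finite (Localization.Away (p : R))
      (LocalizedModule (Submonoid.powers (p : R)) N)]
    [Module.Projective (Localization.Away (p : R))
      (LocalizedModule (Submonoid.powers (p : R)) N)] :
    ∃ (k m : ℕ) (s : N →ₗ[R] (Fin m → R)) (q : (Fin m → R) →ₗ[R] N),
      q ∘ₗ s = ((p : R) ^ k) • LinearMap.id := by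
  exact AdicSplitting.exists_splitting_up_to_pow (p : R) htfR htfN (Localization.Away (p : R))
    (LocalizedModule.mkLinearMap (Submonoid.powers (p : R)) N)
end

section
/- Let p be a prime and R a commutative ring in which every integer coprime to p is invertible. Let 0 → N → Ω → L → 0 be a short exact sequence of R-modules with N and Ω flat over R and with L p-torsion-free. Then for every k ≥ 1: (1) the kernel of the natural map of k-th exterior powers Λ^k_R N → Λ^k_R Ω is annihilated by p^{v_p(k!)}, where v_p(k!) is the p-adic valuation of k!; in particular, if R is p-torsion-free this map is injective; (2) every element of the cokernel of Λ^k_R N → Λ^k_R Ω that is annihilated by some power of p is annihilated by p^{v_p(k!)}. -/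
/-- A linear map is an `a`-torsion-free injection if it is injective with
`a`-torsion-free cokernel. -/
structure LinearMap.IsTorsionFreeInjection {R A B : Type*} [CommRing R] [AddCommGroup A]
    [AddCommGroup B] [Module R A] [Module R B] (a : R) (f : A →ₗ[R] B) : Prop where
  injective : Function.Injective f
  mem_range_of_smul_mem : ∀ y, a • y ∈ LinearMap.range f → y ∈ LinearMap.range f

namespace LinearMap.IsTorsionFreeInjection

open scoped TensorProduct

variable {R A B C D : Type*} [CommRing R] [AddCommGroup A] [AddCommGroup B] [AddCommGroup C]
  [AddCommGroup D] [Module R A] [Module R B] [Module R C] [Module R D] {a : R}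

theorem comp {g : B →ₗ[R] C} {f : A →ₗ[R] B} (hg : g.IsTorsionFreeInjection a)
    (hf : f.IsTorsionFreeInjection a) : (g ∘ₗ f).IsTorsionFreeInjection a where
  injective := hg.injective.comp hf.injective
  mem_range_of_smul_mem y := by
    rintro ⟨x, hx⟩
    obtain ⟨z, rfl⟩ := hg.mem_range_of_smul_mem y ⟨f x, hx⟩
    obtain ⟨w, rfl⟩ := hf.mem_range_of_smul_mem z
      ⟨x, hg.injective (by simpa using hx)⟩
    exact ⟨w, rfl⟩

theorem ofEquiv (e : A ≃ₗ[R] B) : (e : A →ₗ[R] B).IsTorsionFreeInjection a where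
  injective := e.injective
  mem_range_of_smul_mem y _ := ⟨e.symm y, by simp⟩

theorem mem_range_of_pow_smul_mem {f : A →ₗ[R] B} (hf : f.IsTorsionFreeInjection a) (m : ℕ) {y : B}
    (hy : a ^ m • y ∈ LinearMap.range f) : y ∈ LinearMap.range f := by
  induction m with
  | zero => simpa using hy
  | succ m ih =>
    rw [pow_succ', mul_smul] at hy
    exact ih (hf.mem_range_of_smul_mem _ hy)

theorem rTensor (M : Type*) [AddCommGroup M] [Module R M] [Module.Flat R M] {f : A →ₗ[R] B}
    (hf : f.IsTorsionFreeInjection a) : (f.rTensor M).IsTorsionFreeInjection a where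
  injective := Module.Flat.rTensor_preserves_injective_linearMap f hf.injective
  mem_range_of_smul_mem y hy := by
    have hinj : Function.Injective (LinearMap.lsmul R (B ⧸ LinearMap.range f) a) := by
      rw [injective_iff_map_eq_zero]
      intro z hz
      obtain ⟨b, rfl⟩ := Submodule.mkQ_surjective _ z
      rw [LinearMap.lsmul_apply, ← map_smul, Submodule.mkQ_apply,
        Submodule.Quotient.mk_eq_zero] at hz
      rw [Submodule.mkQ_apply, Submodule.Quotient.mk_eq_zero]
      exact hf.mem_range_of_smul_mem b hz
    have hinj' := Module.Flat.rTensor_preserves_injective_linearMap (M := M) _ hinj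
    have hsmul : (LinearMap.lsmul R (B ⧸ LinearMap.range f) a).rTensor M =
        LinearMap.lsmul R _ a := by
      ext; simp [TensorProduct.smul_tmul']
    rw [hsmul] at hinj'
    have hex : Function.Exact (f.rTensor M) ((LinearMap.range f).mkQ.rTensor M) :=
      rTensor_exact M (LinearMap.exact_map_mkQ_range f) (Submodule.mkQ_surjective _)
    refine (hex y).mp (hinj' ?_)
    rw [LinearMap.lsmul_apply, ← map_smul, map_zero]
    exact (hex _).mpr hy

theorem lTensor (M : Type*) [AddCommGroup M] [Module R M] [Module.Flat R M] {f : A →ₗ[R] B}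
    (hf : f.IsTorsionFreeInjection a) : (f.lTensor M).IsTorsionFreeInjection a := by
  have h : f.lTensor M = (TensorProduct.comm R B M : B ⊗[R] M →ₗ[R] M ⊗[R] B) ∘ₗ
      f.rTensor M ∘ₗ (TensorProduct.comm R M A : M ⊗[R] A →ₗ[R] A ⊗[R] M) := by
    ext; simp
  rw [h]
  exact (ofEquiv _).comp ((hf.rTensor M).comp (ofEquiv _))

theorem tensorMap [Module.Flat R B] [Module.Flat R C] {f : A →ₗ[R] B} {g : C →ₗ[R] D}
    (hf : f.IsTorsionFreeInjection a) (hg : g.IsTorsionFreeInjection a) :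
    (TensorProduct.map f g).IsTorsionFreeInjection a := by
  rw [← LinearMap.lTensor_comp_rTensor]
  exact (hg.lTensor B).comp (hf.rTensor C)

end LinearMap.IsTorsionFreeInjection

namespace PiTensorProduct

open scoped TensorProduct

variable {R : Type*} [CommRing R]

instance flat_tensorPower (M : Type*) [AddCommGroup M] [Module R M] [Module.Flat R M] (k : ℕ) :
    Module.Flat R (⨂[R]^k M) := by
  induction k with
  | zero => exact Module.Flat.of_linearEquiv (isEmptyEquiv (Fin 0))
  | succ k ih =>
    have : Module.Flat R (⨂[R]^1 M) := Module.Flat.of_linearEquiv (subsingletonEquiv (0 : Fin 1))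
    exact Module.Flat.of_linearEquiv (TensorPower.mulEquiv (n := k) (m := 1)).symm

theorem isTorsionFreeInjection_map {M N : Type*} [AddCommGroup M] [Module R M] [AddCommGroup N]
    [Module R N] [Module.Flat R M] [Module.Flat R N] {a : R} {f : M →ₗ[R] N}
    (hf : f.IsTorsionFreeInjection a) (k : ℕ) :
    (map (fun _ : Fin k ↦ f)).IsTorsionFreeInjection a := by
  induction k with
  | zero =>
    have h : map (fun _ : Fin 0 ↦ f) =
        (((isEmptyEquiv (Fin 0)).trans (isEmptyEquiv (Fin 0)).symm :
          (⨂[R]^0 M) ≃ₗ[R] (⨂[R]^0 N)) : (⨂[R]^0 M) →ₗ[R] (⨂[R]^0 N)) := by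
      ext v
      simp [Subsingleton.elim (fun i ↦ f (v i)) isEmptyElim]
    rw [h]
    exact .ofEquiv _
  | succ k ih =>
    have h1 : (map (fun _ : Fin 1 ↦ f)).IsTorsionFreeInjection a := by
      have h : map (fun _ : Fin 1 ↦ f) =
          (subsingletonEquiv (s := fun _ : Fin 1 ↦ N) 0).symm.toLinearMap ∘ₗ f ∘ₗ
            (subsingletonEquiv (s := fun _ : Fin 1 ↦ M) 0).toLinearMap := by
        ext v
        simp [show (fun i ↦ f (v i)) = fun _ ↦ f (v 0) from
          funext fun i ↦ by rw [Subsingleton.elim i 0]]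
      rw [h]
      exact (LinearMap.IsTorsionFreeInjection.ofEquiv _).comp (hf.comp (.ofEquiv _))
    have h : map (fun _ : Fin (k + 1) ↦ f) =
        (TensorPower.mulEquiv : (⨂[R]^k N) ⊗[R] (⨂[R]^1 N) ≃ₗ[R] (⨂[R]^(k + 1) N)).toLinearMap ∘ₗ
          TensorProduct.map (map (fun _ : Fin k ↦ f)) (map (fun _ : Fin 1 ↦ f)) ∘ₗ
            (TensorPower.mulEquiv :
              (⨂[R]^k M) ⊗[R] (⨂[R]^1 M) ≃ₗ[R] (⨂[R]^(k + 1) M)).symm.toLinearMap := by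
      ext v
      simp only [TensorPower.mulEquiv, LinearMap.compMultilinearMap_apply, LinearMap.comp_apply,
        LinearEquiv.coe_coe, LinearEquiv.trans_symm, LinearEquiv.trans_apply, reindex_symm,
        reindex_tprod, tmulEquiv_symm_apply, TensorProduct.map_tmul, map_tprod, tmulEquiv_apply]
      congr 1
      ext i
      obtain ⟨i, rfl⟩ := finSumFinEquiv.surjective i
      cases i <;> simp
    rw [h]
    exact (LinearMap.IsTorsionFreeInjection.ofEquiv _).comp
      ((ih.tensorMap h1).comp (.ofEquiv _))

end PiTensorProduct

namespace exteriorPower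

open scoped TensorProduct

variable {R M N : Type*} [CommRing R] [AddCommGroup M] [Module R M] [AddCommGroup N] [Module R N]

variable (R M) in
/-- The canonical projection from the tensor power to the exterior power. -/
noncomputable def ofTensorPower (k : ℕ) : (⨂[R]^k M) →ₗ[R] ⋀[R]^k M :=
  PiTensorProduct.lift (ιMulti R k).toMultilinearMap

theorem ofTensorPower_toTensorPower {k : ℕ} (x : ⋀[R]^k M) :
    ofTensorPower R M k (toTensorPower R M k x) = k.factorial • x := by
  have h : ofTensorPower R M k ∘ₗ toTensorPower R M k = k.factorial • LinearMap.id := by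
    ext v : 2
    have := DFunLike.congr_fun (AlternatingMap.coe_alternatization (ιMulti R k (M := M))) v
    rw [MultilinearMap.alternatization_apply] at this
    simpa [ofTensorPower, map_sum] using this
  simpa using DFunLike.congr_fun h x

theorem toTensorPower_map (f : M →ₗ[R] N) {k : ℕ} (x : ⋀[R]^k M) :
    toTensorPower R N k (map k f x) =
      PiTensorProduct.map (fun _ ↦ f) (toTensorPower R M k x) := by
  have h : toTensorPower R N k ∘ₗ map k f =
      PiTensorProduct.map (fun _ ↦ f) ∘ₗ toTensorPower R M k := by
    ext v : 2
    simp [map_sum]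
  exact DFunLike.congr_fun h x

theorem map_ofTensorPower (f : M →ₗ[R] N) {k : ℕ} (x : ⨂[R]^k M) :
    map k f (ofTensorPower R M k x) =
      ofTensorPower R N k (PiTensorProduct.map (fun _ ↦ f) x) := by
  have h : map k f ∘ₗ ofTensorPower R M k =
      ofTensorPower R N k ∘ₗ PiTensorProduct.map (fun _ ↦ f) := by
    ext v : 2
    simp [ofTensorPower, Function.comp_def]
  exact DFunLike.congr_fun h x

theorem coe_map (f : M →ₗ[R] N) {k : ℕ} (x : ⋀[R]^k M) :
    (map k f x : ExteriorAlgebra R N) = ExteriorAlgebra.map f x := by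
  have h : (⋀[R]^k N).subtype ∘ₗ map k f =
      (ExteriorAlgebra.map f).toLinearMap ∘ₗ (⋀[R]^k M).subtype := by
    ext v : 2
    simp
  exact DFunLike.congr_fun h x

variable [Module.Flat R M] [Module.Flat R N] {a : R} {f : M →ₗ[R] N} {k : ℕ}

theorem factorial_smul_eq_zero_of_map_eq_zero (hf : f.IsTorsionFreeInjection a) {x : ⋀[R]^k M}
    (hx : map k f x = 0) : k.factorial • x = 0 := by
  rw [← ofTensorPower_toTensorPower,
    (PiTensorProduct.isTorsionFreeInjection_map hf k).injective
      (a₁ := toTensorPower R M k x) (a₂ := 0) (by rw [← toTensorPower_map, hx, map_zero, map_zero]),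
    map_zero]

theorem factorial_smul_mem_range_map (hf : f.IsTorsionFreeInjection a) {y : ⋀[R]^k N} {m : ℕ}
    (hy : a ^ m • y ∈ LinearMap.range (map k f)) :
    k.factorial • y ∈ LinearMap.range (map k f) := by
  obtain ⟨x, hx⟩ := hy
  obtain ⟨z, hz⟩ := (PiTensorProduct.isTorsionFreeInjection_map hf k).mem_range_of_pow_smul_mem m
    (y := toTensorPower R N k y) ⟨toTensorPower R M k x, by rw [← toTensorPower_map, hx, map_smul]⟩
  exact ⟨ofTensorPower R M k z, by rw [map_ofTensorPower, hz, ofTensorPower_toTensorPower]⟩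

end exteriorPower

namespace ExteriorAlgebra

variable {R F M : Type*} [CommRing R] [AddCommGroup F] [Module R F] [AddCommGroup M] [Module R M]

theorem map_mkQ_eq_zero_of_le {K K' : Submodule R F} (h : K ≤ K') {z : ExteriorAlgebra R F}
    (hz : map K.mkQ z = 0) : map K'.mkQ z = 0 := by
  have : K'.mkQ = Submodule.factor h ∘ₗ K.mkQ := by ext; simp
  rw [this, ← map_comp_map, AlgHom.comp_apply, hz, map_zero]

/-- The elements that vanish in the exterior algebra of `F ⧸ K` for some finitely generated
`K ≤ P`. -/
def fgKernel (P : Submodule R F) : Ideal (ExteriorAlgebra R F) where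
  carrier := {z | ∃ K : Submodule R F, K.FG ∧ K ≤ P ∧ map K.mkQ z = 0}
  zero_mem' := ⟨⊥, Submodule.fg_bot, bot_le, map_zero _⟩
  add_mem' := by
    rintro y z ⟨K, hK, hKP, hy⟩ ⟨K', hK', hKP', hz⟩
    refine ⟨K ⊔ K', hK.sup hK', sup_le hKP hKP', ?_⟩
    rw [map_add, map_mkQ_eq_zero_of_le le_sup_left hy, map_mkQ_eq_zero_of_le le_sup_right hz,
      add_zero]
  smul_mem' := by
    rintro y z ⟨K, hK, hKP, hz⟩
    exact ⟨K, hK, hKP, by rw [smul_eq_mul, map_mul, hz, mul_zero]⟩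

instance (P : Submodule R F) : (fgKernel P).IsTwoSided where
  mul_mem_of_left := by
    rintro z y ⟨K, hK, hKP, hz⟩
    exact ⟨K, hK, hKP, by rw [map_mul, hz, zero_mul]⟩

/-- An element killed by the map induced by a surjection `π` is already killed after dividing out
finitely many elements of the kernel of `π`. -/
theorem exists_fg_of_map_eq_zero {π : F →ₗ[R] M} (hπ : Function.Surjective π)
    {z : ExteriorAlgebra R F} (hz : map π z = 0) :
    ∃ K : Submodule R F, K.FG ∧ K ≤ LinearMap.ker π ∧ map K.mkQ z = 0 := by
  set I := fgKernel (LinearMap.ker π)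
  let q : ExteriorAlgebra R F →ₐ[R] ExteriorAlgebra R F ⧸ I := Ideal.Quotient.mkₐ R I
  have hker : LinearMap.ker π ≤ LinearMap.ker (q.toLinearMap ∘ₗ ι R) := by
    intro x hx
    refine Ideal.Quotient.eq_zero_iff_mem.mpr ⟨R ∙ x, Submodule.fg_span_singleton x, ?_, ?_⟩
    · simpa [Submodule.span_le] using hx
    · rw [map_apply_ι, Submodule.mkQ_apply, (Submodule.Quotient.mk_eq_zero _).mpr
        (Submodule.mem_span_singleton_self x), map_zero]
  let l : M →ₗ[R] ExteriorAlgebra R F ⧸ I :=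
    (LinearMap.ker π).liftQ _ hker ∘ₗ (π.quotKerEquivOfSurjective hπ).symm.toLinearMap
  have hl (x : F) : l (π x) = q (ι R x) := by
    have : (π.quotKerEquivOfSurjective hπ).symm (π x) = Submodule.Quotient.mk x := by
      rw [LinearEquiv.symm_apply_eq]; rfl
    simp [l, this]
  have hsq (m : M) : l m * l m = 0 := by
    obtain ⟨x, rfl⟩ := hπ m
    rw [hl, ← map_mul, ι_sq_zero, map_zero]
  have hq : (lift R ⟨l, hsq⟩).comp (map π) = q := by
    ext x
    simp [hl]
  have : q z = 0 := by rw [← hq, AlgHom.comp_apply, hz, map_zero]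
  exact Ideal.Quotient.eq_zero_iff_mem.mp this

instance [Module.Free R M] : Module.Free R (ExteriorAlgebra R M) := by
  obtain ⟨I, b⟩ := Module.Free.exists_basis (R := R) (M := M)
  classical
  let : LinearOrder I := linearOrderOfSTO WellOrderingRel
  exact .of_basis b.ExteriorAlgebra

end ExteriorAlgebra

/-- A map from a free module to a flat module which kills a finitely generated submodule
factors through a free module in which that submodule is killed. -/
theorem Module.Flat.exists_factorization_of_fg_le_ker {R ι M : Type*} [CommRing R]
    [AddCommGroup M] [Module R M] [Module.Flat R M] {π : (ι →₀ R) →ₗ[R] M}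
    {K : Submodule R (ι →₀ R)} (hK : K.FG) (hKπ : K ≤ LinearMap.ker π) :
    ∃ (n : ℕ) (a : (ι →₀ R) →ₗ[R] (Fin n →₀ R) × (ι →₀ R))
      (y : (Fin n →₀ R) × (ι →₀ R) →ₗ[R] M), π = y ∘ₗ a ∧ K ≤ LinearMap.ker a := by
  classical
  obtain ⟨t, rfl⟩ := hK
  let s : Finset ι := t.biUnion Finsupp.support
  let i : (s →₀ R) →ₗ[R] (ι →₀ R) := Finsupp.lmapDomain R R Subtype.val
  let r : (ι →₀ R) →ₗ[R] (s →₀ R) := Finsupp.lsubtypeDomain (s : Set ι)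
  have hir : ∀ x ∈ Submodule.span R (t : Set (ι →₀ R)), i (r x) = x := by
    intro x hx
    refine Submodule.span_induction (p := fun x _ ↦ i (r x) = x) ?_ ?_ ?_ ?_ hx
    · intro x hx
      ext j
      by_cases hj : j ∈ s
      · exact Finsupp.mapDomain_apply Subtype.val_injective (r x) ⟨j, hj⟩
      · rw [show i (r x) j = 0 from Finsupp.mapDomain_of_notMem_range _ _ (by simpa using hj),
          eq_comm, ← Finsupp.notMem_support_iff]
        exact fun h ↦ hj (Finset.mem_biUnion.mpr ⟨x, hx, h⟩)
    · simp
    · intro x y _ _ hx hy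
      rw [map_add, map_add, hx, hy]
    · intro c x _ hx
      rw [map_smul, map_smul, hx]
  have : Module.Finite R (Submodule.span R (t : Set (ι →₀ R))) :=
    Module.Finite.span_finset R t
  obtain ⟨n, a, y, hya, ha⟩ := Module.Flat.exists_factorization_of_comp_eq_zero_of_free
    (K := Submodule.span R (t : Set (ι →₀ R)))
    (f := r ∘ₗ (Submodule.span R (t : Set (ι →₀ R))).subtype)
    (x := π ∘ₗ i) (by
      ext x
      simpa [hir x x.2] using hKπ x.2)
  refine ⟨n, (a ∘ₗ r).prod (LinearMap.id - i ∘ₗ r), y.coprod π, ?_, fun x hx ↦ ?_⟩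
  · ext j
    have := DFunLike.congr_fun hya (r (Finsupp.single j 1))
    simp only [LinearMap.comp_apply] at this
    simp [← this]
  · have := DFunLike.congr_fun ha ⟨x, hx⟩
    simp only [LinearMap.comp_apply, Submodule.subtype_apply] at this
    simp [this, hir x hx]

namespace ExteriorAlgebra

theorem eq_zero_of_smul_eq_zero_of_flat {R M : Type*} [CommRing R] [AddCommGroup M] [Module R M]
    [Module.Flat R M] {r : R} (hr : ∀ a : R, r * a = 0 → a = 0) {x : ExteriorAlgebra R M}
    (hx : r • x = 0) : x = 0 := by
  let π : (M →₀ R) →ₗ[R] M := Finsupp.linearCombination R id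
  have hπ : Function.Surjective π := Finsupp.linearCombination_id_surjective R M
  obtain ⟨z, rfl⟩ := map_surjective_iff.mpr hπ x
  rw [← map_smul] at hx
  obtain ⟨K, hK, hKπ, hz⟩ := exists_fg_of_map_eq_zero hπ hx
  obtain ⟨n, a, y, hya, ha⟩ := Module.Flat.exists_factorization_of_fg_le_ker hK hKπ
  have hfac : a = K.liftQ a ha ∘ₗ K.mkQ := by rw [Submodule.liftQ_mkQ]
  have haz : r • map a z = 0 := by
    rw [← map_smul, hfac, ← map_comp_map, AlgHom.comp_apply, hz, map_zero]
  have haz' : map a z = 0 := by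
    let b := Module.Free.chooseBasis R (ExteriorAlgebra R ((Fin n →₀ R) × (M →₀ R)))
    refine b.repr.map_eq_zero_iff.mp (Finsupp.ext fun j ↦ hr _ ?_)
    simpa using DFunLike.congr_fun (congrArg b.repr haz) j
  rw [hya, ← map_comp_map, AlgHom.comp_apply, haz', map_zero]

end ExteriorAlgebra

/-- Let `R` be a commutative ring in which every integer coprime to the
prime `p` is invertible, and let `0 → N → Ω → L → 0` be a short exact sequence of
`R`-modules with `N, Ω` flat and `L` `p`-torsion-free.  Then for each `k ≥ 1`, writing
`v = v_p(k!)` and regarding the `k`-th exterior powers `⋀[R]^k N ⊆ ExteriorAlgebra R N`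
(with the induced map `ExteriorAlgebra.map f`):
(1) the kernel of `Λᵏ N → Λᵏ Ω` is annihilated by `p^v`; in particular it is injective
when `R` is `p`-torsion-free; and
(2) every `p`-power-torsion element of the cokernel of `Λᵏ N → Λᵏ Ω` is annihilated by
`p^v`. -/
theorem exterior_power_kernel_cokernel_bounded
    (p : ℕ) (hp : p.Prime) (R : Type*) [CommRing R]
    (hinv : ∀ n : ℕ, ¬ p ∣ n → IsUnit (n : R))
    (N Ω L : Type*) [AddCommGroup N] [Module R N] [AddCommGroup Ω] [Module R Ω]
    [AddCommGroup L] [Module R L]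
    [Module.Flat R N] [Module.Flat R Ω]
    (htfL : ∀ x : L, (p : R) • x = 0 → x = 0)
    (f : N →ₗ[R] Ω) (g : Ω →ₗ[R] L)
    (hf : Function.Injective f) (hg : Function.Surjective g)
    (hfg : LinearMap.range f = LinearMap.ker g)
    (k : ℕ) (hk : 1 ≤ k) :
    (∀ x : ExteriorAlgebra R N, x ∈ ⋀[R]^k N →
      ExteriorAlgebra.map f x = 0 →
        ((p : R) ^ (padicValNat p (Nat.factorial k))) • x = 0) ∧
    ((∀ a : R, (p : R) * a = 0 → a = 0) →
      ∀ x : ExteriorAlgebra R N, x ∈ ⋀[R]^k N → ExteriorAlgebra.map f x = 0 → x = 0) ∧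
    (∀ y : ExteriorAlgebra R Ω, y ∈ ⋀[R]^k Ω →
      (∃ (m : ℕ) (x : ExteriorAlgebra R N), x ∈ ⋀[R]^k N ∧
          ((p : R) ^ m) • y = ExteriorAlgebra.map f x) →
      ∃ x : ExteriorAlgebra R N, x ∈ ⋀[R]^k N ∧
        ((p : R) ^ (padicValNat p (Nat.factorial k))) • y = ExteriorAlgebra.map f x) := by
  have hfp : f.IsTorsionFreeInjection (p : R) := by
    refine ⟨hf, fun y hy ↦ ?_⟩
    rw [hfg, LinearMap.mem_ker] at hy ⊢
    exact htfL _ (by rwa [map_smul] at hy)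
  obtain ⟨u, hu⟩ : ∃ u : R, u * (k.factorial : R) = (p : R) ^ padicValNat p k.factorial := by
    have : Fact p.Prime := ⟨hp⟩
    obtain ⟨c, hc⟩ := pow_padicValNat_dvd (p := p) (n := k.factorial)
    have hpc : ¬ p ∣ c := by
      rintro ⟨d, rfl⟩
      refine pow_succ_padicValNat_not_dvd (p := p) k.factorial_ne_zero ⟨d, ?_⟩
      rw [pow_succ, mul_assoc, ← hc]
    obtain ⟨w, hw⟩ := (hinv c hpc).exists_left_inv
    refine ⟨w, ?_⟩
    conv_lhs => rw [hc]
    push_cast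
    rw [mul_left_comm, hw, mul_one]
  have hker : ∀ x : ExteriorAlgebra R N, x ∈ ⋀[R]^k N → ExteriorAlgebra.map f x = 0 →
      ((p : R) ^ (padicValNat p (Nat.factorial k))) • x = 0 := by
    intro x hx hfx
    have h := exteriorPower.factorial_smul_eq_zero_of_map_eq_zero hfp (x := ⟨x, hx⟩)
      (Subtype.ext (by rw [exteriorPower.coe_map]; exact hfx))
    have h' : (k.factorial : R) • x = 0 := by
      rw [Nat.cast_smul_eq_nsmul]
      exact congrArg Subtype.val h
    rw [← hu, mul_smul, h', smul_zero]
  refine ⟨hker, fun htf x hx hfx ↦ ?_, ?_⟩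
  · refine ExteriorAlgebra.eq_zero_of_smul_eq_zero_of_flat ?_ (hker x hx hfx)
    induction padicValNat p k.factorial with
    | zero => simp
    | succ m ih => exact fun a ha ↦ ih a (htf _ (by rwa [pow_succ', mul_assoc] at ha))
  · rintro y hy ⟨m, x, hx, hxy⟩
    obtain ⟨z, hz⟩ := exteriorPower.factorial_smul_mem_range_map hfp (y := ⟨y, hy⟩) (m := m)
      ⟨⟨x, hx⟩, Subtype.ext (by rw [exteriorPower.coe_map]; exact hxy.symm)⟩
    refine ⟨u • z, Submodule.smul_mem _ _ z.2, ?_⟩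
    rw [map_smul, ← exteriorPower.coe_map, hz, ← hu, mul_smul, Nat.cast_smul_eq_nsmul]
    rfl
end

section
/- Let X be a profinite topological space (a compact, Hausdorff, totally disconnected space), A a commutative ring, and M an A-module. Then the natural A-linear map LocallyConstant(X, A) ⊗_A M → LocallyConstant(X, M), sending f ⊗ m to the function x ↦ f(x)·m, is an isomorphism. Consequently, LocallyConstant(X, A) is a flat A-module. -/
open TensorProduct

namespace LocallyConstant

variable {X A M N : Type*} [TopologicalSpace X]
  [CommRing A] [AddCommGroup M] [Module A M] [AddCommGroup N] [Module A N]

/-- The natural map `LocallyConstant(X, A) ⊗[A] M → LocallyConstant(X, M)`. -/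
def tensorMap (X A M : Type*) [TopologicalSpace X] [CommRing A] [AddCommGroup M] [Module A M] :
    LocallyConstant X A ⊗[A] M →ₗ[A] LocallyConstant X M :=
  TensorProduct.lift
    (LinearMap.mk₂ A
      (fun (f : LocallyConstant X A) (m : M) => LocallyConstant.map (fun a => a • m) f)
      (fun f g m => by ext x; simp [add_smul])
      (fun c f m => by ext x; simp [mul_smul])
      (fun f m m' => by ext x; simp [smul_add])
      (fun c f m => by ext x; exact smul_comm _ _ _))

@[simp]
theorem tensorMap_tmul_apply (f : LocallyConstant X A) (m : M) (x : X) :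
    tensorMap X A M (f ⊗ₜ m) x = f x • m :=
  rfl

theorem sum_apply {ι Y : Type*} [AddCommMonoid Y] (s : Finset ι) (f : ι → LocallyConstant X Y)
    (x : X) : (∑ i ∈ s, f i) x = ∑ i ∈ s, f i x :=
  map_sum (evalAddMonoidHom x) f s

theorem tensorMap_naturality (l : M →ₗ[A] N) (t : LocallyConstant X A ⊗[A] M) :
    tensorMap X A N (l.lTensor _ t) = (tensorMap X A M t).map l := by
  induction t with
  | zero => ext; simp
  | tmul f m => ext; simp
  | add s t hs ht => ext; simp [hs, ht]

variable [CompactSpace X]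

open Classical in
/-- A function factoring through a locally constant map `F` is a linear combination of the
indicator functions of the fibres of `F`. -/
theorem map_eq_sum_smul_charFn {Y : Type*} (F : LocallyConstant X Y) (h : Y → A) :
    F.map h = ∑ y ∈ F.range_finite.toFinset,
      h y • charFn A (F.isLocallyConstant.isClopen_fiber y) := by
  ext x
  simp [sum_apply, coe_charFn, Set.indicator_apply]

theorem tensorMap_surjective : Function.Surjective (tensorMap X A M) := by
  classical
  intro g
  refine ⟨∑ m ∈ g.range_finite.toFinset,
    charFn A (g.isLocallyConstant.isClopen_fiber m) ⊗ₜ m, ?_⟩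
  ext x
  simp [sum_apply, coe_charFn, Set.indicator_apply]

theorem tensorMap_injective : Function.Injective (tensorMap X A M) := by
  rw [injective_iff_map_eq_zero]
  intro t ht
  obtain ⟨n, f, m, rfl⟩ := TensorProduct.exists_sum_tmul_eq t
  let F : LocallyConstant X (Fin n → A) := unflip f
  have hf (j : Fin n) : f j = F.map (fun y => y j) := rfl
  simp_rw [hf, map_eq_sum_smul_charFn, TensorProduct.sum_tmul, TensorProduct.smul_tmul]
  rw [Finset.sum_comm]
  refine Finset.sum_eq_zero fun y hy => ?_
  obtain ⟨x, rfl⟩ := F.range_finite.mem_toFinset.mp hy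
  have hx : ∑ j, f j x • m j = 0 := by
    simpa [sum_apply] using LocallyConstant.congr_fun ht x
  rw [← TensorProduct.tmul_sum]
  exact (congrArg _ hx).trans (TensorProduct.tmul_zero _ _)

theorem tensorMap_bijective : Function.Bijective (tensorMap X A M) :=
  ⟨tensorMap_injective, tensorMap_surjective⟩

instance flat : Module.Flat A (LocallyConstant X A) := by
  rw [Module.Flat.iff_lTensor_preserves_injective_linearMap]
  intro N N' _ _ _ _ l hl s t hst
  apply tensorMap_injective
  ext x
  apply hl
  simpa [tensorMap_naturality] using LocallyConstant.congr_fun (congrArg (tensorMap X A N') hst) x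

end LocallyConstant

/-- For a profinite space `X`, a commutative ring `A` and an
`A`-module `M`, the natural map
`LocallyConstant(X, A) ⊗[A] M → LocallyConstant(X, M)`, `f ⊗ m ↦ (x ↦ f x • m)`,
is an isomorphism; consequently `LocallyConstant(X, A)` is a flat `A`-module. -/
theorem locallyConstant_tensor_bijective_and_flat
    (X : Type*) [TopologicalSpace X] [CompactSpace X] [T2Space X]
    [TotallyDisconnectedSpace X]
    (A : Type*) [CommRing A] (M : Type*) [AddCommGroup M] [Module A M] :
    Function.Bijective
      (TensorProduct.lift
        (LinearMap.mk₂ A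
          (fun (f : LocallyConstant X A) (m : M) =>
            LocallyConstant.map (fun a => a • m) f)
          (fun f g m => by ext x; simp [LocallyConstant.map_apply, add_smul])
          (fun c f m => by ext x; simp [LocallyConstant.map_apply, mul_smul])
          (fun f m m' => by ext x; simp [LocallyConstant.map_apply, smul_add])
          (fun c f m => by
            ext x
            simp only [LocallyConstant.map_apply, LocallyConstant.coe_smul,
              Function.comp_apply, Pi.smul_apply]
            exact smul_comm _ _ _))) ∧
    Module.Flat A (LocallyConstant X A) :=
  ⟨LocallyConstant.tensorMap_bijective, LocallyConstant.flat⟩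
end

section
/- Let p be a prime, M an abelian group which is p-adically complete, and N ⊆ M a subgroup which is closed in the p-adic topology of M, i.e. every x ∈ M such that for all n there exists y ∈ N with x − y ∈ p^n M belongs to N. Then: (1) N is p-adically complete, and M/N is p-adically complete (in particular ⋂_n p^n(M/N) = 0); (2) if M/N has bounded p^∞-torsion, say (M/N)[p^∞] = (M/N)[p^d], then for every n ≥ 0 one has p^{n+d}M ∩ N ⊆ p^n N, so the topology induced on N from M agrees with the p-adic topology of N; (3) conversely, if M has bounded p^∞-torsion and for every n there exists n′ with p^{n′}M ∩ N ⊆ p^n N, then M/N has bounded p^∞-torsion. -/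
theorem smodEq_span_singleton_pow_iff {p : ℕ} {M : Type*} [AddCommGroup M] {n : ℕ} {x y : M} :
    x ≡ y [SMOD ((Ideal.span {(p : ℤ)}) ^ n • ⊤ : Submodule ℤ M)] ↔
      ∃ z : M, x - y = (p ^ n) • z := by
  rw [SModEq.sub_mem, Ideal.span_singleton_pow, Submodule.ideal_span_singleton_smul,
    Submodule.mem_smul_pointwise_iff_exists]
  simp only [Submodule.mem_top, true_and]
  refine exists_congr fun z ↦ ?_
  rw [eq_comm, ← Nat.cast_pow, Nat.cast_smul_eq_nsmul]

theorem isHausdorff_span_singleton_of_forall {p : ℕ} {M : Type*} [AddCommGroup M]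
    (h : ∀ x : M, (∀ n : ℕ, ∃ z : M, x = (p ^ n) • z) → x = 0) :
    IsHausdorff (Ideal.span {(p : ℤ)}) M where
  haus' x hx := h x fun n ↦ by
    simpa only [sub_zero] using smodEq_span_singleton_pow_iff.mp (hx n)

theorem eq_zero_of_forall_eq_pow_smul {p : ℕ} {M : Type*} [AddCommGroup M]
    [IsHausdorff (Ideal.span {(p : ℤ)}) M] {x : M}
    (h : ∀ n : ℕ, ∃ z : M, x = (p ^ n) • z) : x = 0 :=
  IsHausdorff.haus ‹_› x fun n ↦ smodEq_span_singleton_pow_iff.mpr (by simpa using h n)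

/-- A sequence `y` has a `p`-adic sum if there is a family of tails
`s n = ∑ k, p ^ k • y (n + k)`, characterized by `s n = y n + p • s (n + 1)`. -/
theorem isPrecomplete_span_singleton_of_tails {p : ℕ} {M : Type*} [AddCommGroup M]
    (h : ∀ y : ℕ → M, ∃ s : ℕ → M, ∀ n, s n = y n + p • s (n + 1)) :
    IsPrecomplete (Ideal.span {(p : ℤ)}) M where
  prec' f hf := by
    choose g hg using fun n ↦ smodEq_span_singleton_pow_iff.mp (hf (Nat.le_succ n)).symm
    obtain ⟨s, hs⟩ := h g
    have key (n : ℕ) : f 0 + s 0 = f n + (p ^ n) • s n := by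
      induction n with
      | zero => simp
      | succ n ih =>
        rw [ih, hs n, smul_add, ← hg n, smul_smul, ← pow_succ, Nat.succ_eq_add_one]
        abel
    refine ⟨f 0 + s 0, fun n ↦ (smodEq_span_singleton_pow_iff.mpr ⟨s n, ?_⟩).symm⟩
    rw [key n, add_sub_cancel_left]

theorem exists_tails_of_isAdicComplete_span_singleton {p : ℕ} {M : Type*} [AddCommGroup M]
    [IsAdicComplete (Ideal.span {(p : ℤ)}) M] (y : ℕ → M) :
    ∃ s : ℕ → M, ∀ n, s n = y n + p • s (n + 1) := by
  have hlim (n : ℕ) : ∃ L : M, ∀ m : ℕ, ∃ z : M,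
      ∑ k ∈ Finset.range m, (p ^ k) • y (n + k) - L = (p ^ m) • z := by
    obtain ⟨L, hL⟩ := IsPrecomplete.prec (I := Ideal.span {(p : ℤ)}) inferInstance
      (f := fun m ↦ ∑ k ∈ Finset.range m, (p ^ k) • y (n + k)) (fun {a b} hab ↦ by
        refine SModEq.symm (smodEq_span_singleton_pow_iff.mpr
          ⟨∑ k ∈ Finset.range (b - a), (p ^ k) • y (n + (a + k)), ?_⟩)
        obtain ⟨c, rfl⟩ := Nat.exists_eq_add_of_le hab
        simp only [Finset.sum_range_add, add_sub_cancel_left, Nat.add_sub_cancel_left,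
          Finset.smul_sum, smul_smul, pow_add])
    exact ⟨L, fun m ↦ smodEq_span_singleton_pow_iff.mp (hL m)⟩
  choose s hs using hlim
  refine ⟨s, fun n ↦ sub_eq_zero.mp (eq_zero_of_forall_eq_pow_smul (p := p) fun m ↦ ?_)⟩
  obtain ⟨a, ha⟩ := hs n (m + 1)
  obtain ⟨b, hb⟩ := hs (n + 1) m
  refine ⟨p • b - p • a, ?_⟩
  have hsum : ∑ k ∈ Finset.range (m + 1), (p ^ k) • y (n + k) =
      y n + p • ∑ k ∈ Finset.range m, (p ^ k) • y (n + 1 + k) := by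
    rw [Finset.sum_range_succ', add_comm]
    simp only [pow_zero, one_smul, add_zero, Finset.smul_sum, smul_smul, pow_succ']
    simp only [add_assoc, add_comm 1]
  rw [smul_sub, smul_smul, smul_smul, ← pow_succ, ← ha, hsum, pow_succ', mul_smul, ← hb, smul_sub]
  abel

theorem eq_sum_add_pow_smul_of_tails {p : ℕ} {M : Type*} [AddCommGroup M] {y s : ℕ → M}
    (h : ∀ n, s n = y n + p • s (n + 1)) (n m : ℕ) :
    s n = ∑ k ∈ Finset.range m, (p ^ k) • y (n + k) + (p ^ m) • s (n + m) := by
  induction m with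
  | zero => simp
  | succ m ih =>
    rw [ih, h (n + m), Finset.sum_range_succ, smul_add, smul_smul, ← pow_succ, add_assoc, add_assoc]


/-- Let `M` be a `p`-adically complete abelian group and `N ⊆ M` a
subgroup closed in the `p`-adic topology.  Then:
(1) `N` and `M/N` are `p`-adically complete;
(2) if `(M/N)[p^∞] = (M/N)[p^d]` then `p^{n+d}M ∩ N ⊆ pⁿN` for all `n`, so the
    induced topology on `N` agrees with its `p`-adic topology;
(3) conversely, if `M` has bounded `p^∞`-torsion and for every `n` there is `n′` with
    `p^{n′}M ∩ N ⊆ pⁿN`, then `M/N` has bounded `p^∞`-torsion. -/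
theorem closed_subgroup_p_adically_complete
    (p : ℕ) (hp : p.Prime) (M : Type*) [AddCommGroup M]
    [IsAdicComplete (Ideal.span {(p : ℤ)}) M]
    (N : AddSubgroup M)
    (hclosed : ∀ x : M, (∀ n : ℕ, ∃ y ∈ N, ∃ z : M, x - y = (p ^ n) • z) → x ∈ N) :
    (IsAdicComplete (Ideal.span {(p : ℤ)}) N ∧
      IsAdicComplete (Ideal.span {(p : ℤ)}) (M ⧸ N)) ∧
    (∀ d : ℕ, (∀ q : M ⧸ N, (∃ n : ℕ, (p ^ n) • q = 0) → (p ^ d) • q = 0) →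
      ∀ n : ℕ, ∀ x : M, x ∈ N → (∃ z : M, x = (p ^ (n + d)) • z) →
        ∃ y ∈ N, x = (p ^ n) • y) ∧
    ((∃ n₀ : ℕ, ∀ x : M, (∃ n : ℕ, (p ^ n) • x = 0) → (p ^ n₀) • x = 0) →
      (∀ n : ℕ, ∃ n' : ℕ, ∀ x : M, x ∈ N → (∃ z : M, x = (p ^ n') • z) →
        ∃ y ∈ N, x = (p ^ n) • y) →
      ∃ d : ℕ, ∀ q : M ⧸ N, (∃ n : ℕ, (p ^ n) • q = 0) → (p ^ d) • q = 0) := by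
  refine ⟨⟨?_, ?_⟩, ?_, ?_⟩
  · have : IsHausdorff (Ideal.span {(p : ℤ)}) N := isHausdorff_span_singleton_of_forall
      fun x hx ↦ Subtype.ext <| eq_zero_of_forall_eq_pow_smul (p := p) fun n ↦ by
        obtain ⟨z, rfl⟩ := hx n
        exact ⟨z, rfl⟩
    have : IsPrecomplete (Ideal.span {(p : ℤ)}) N := isPrecomplete_span_singleton_of_tails
      fun y ↦ by
        obtain ⟨s, hs⟩ := exists_tails_of_isAdicComplete_span_singleton (p := p) (fun n ↦ (y n : M))
        have hmem (n : ℕ) : s n ∈ N := hclosed _ fun m ↦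
          ⟨∑ k ∈ Finset.range m, (p ^ k) • (y (n + k) : M),
            N.sum_mem fun k _ ↦ N.nsmul_mem (y (n + k)).2 _, s (n + m),
            by rw [eq_sum_add_pow_smul_of_tails hs n m, add_sub_cancel_left]⟩
        exact ⟨fun n ↦ ⟨s n, hmem n⟩, fun n ↦ Subtype.ext (hs n)⟩
    constructor
  · have : IsHausdorff (Ideal.span {(p : ℤ)}) (M ⧸ N) := isHausdorff_span_singleton_of_forall
      fun q hq ↦ by
        induction q using QuotientAddGroup.induction_on with | H x => ?_
        refine (QuotientAddGroup.eq_zero_iff x).mpr (hclosed x fun n ↦ ?_)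
        obtain ⟨w, hw⟩ := hq n
        induction w using QuotientAddGroup.induction_on with | H z => ?_
        refine ⟨x - (p ^ n) • z, ?_, z, sub_sub_cancel _ _⟩
        rw [← QuotientAddGroup.eq_zero_iff, QuotientAddGroup.mk_sub, hw,
          QuotientAddGroup.mk_nsmul, sub_self]
    have : IsPrecomplete (Ideal.span {(p : ℤ)}) (M ⧸ N) := isPrecomplete_span_singleton_of_tails
      fun y ↦ by
        choose x hx using fun n ↦ QuotientAddGroup.mk_surjective (y n)
        obtain ⟨s, hs⟩ := exists_tails_of_isAdicComplete_span_singleton (p := p) x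
        refine ⟨fun n ↦ (s n : M ⧸ N), fun n ↦ ?_⟩
        simp only [← hx]
        rw [hs n, QuotientAddGroup.mk_add, QuotientAddGroup.mk_nsmul]
    constructor
  · rintro d hd n x hx ⟨z, rfl⟩
    refine ⟨(p ^ d) • z, ?_, by rw [smul_smul, pow_add]⟩
    rw [← QuotientAddGroup.eq_zero_iff, QuotientAddGroup.mk_nsmul]
    refine hd z ⟨n + d, ?_⟩
    rwa [← QuotientAddGroup.mk_nsmul, QuotientAddGroup.eq_zero_iff]
  · rintro ⟨n₀, hn₀⟩ h
    obtain ⟨n', hn'⟩ := h (n₀ + 1)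
    have descend (x : M) (j : ℕ) (hx : (p ^ (n' + (n₀ + 1) + j)) • x ∈ N) :
        (p ^ (n' + (n₀ + 1))) • x ∈ N := by
      induction j with
      | zero => exact hx
      | succ j ih =>
        refine ih ?_
        obtain ⟨y, hy, hxy⟩ := hn' _ hx ⟨(p ^ (n₀ + 1 + (j + 1))) • x, by
          rw [smul_smul, ← pow_add]
          congr 2
          omega⟩
        have htors : (p ^ n₀) • ((p ^ (n' + (j + 1))) • x - y) = 0 := hn₀ _ ⟨n₀ + 1, by
          rw [smul_sub, ← hxy, smul_smul, ← pow_add, sub_eq_zero]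
          congr 2
          omega⟩
        rw [smul_sub, sub_eq_zero, smul_smul, ← pow_add] at htors
        rw [show n' + (n₀ + 1) + j = n₀ + (n' + (j + 1)) by omega, htors]
        exact N.nsmul_mem hy _
    refine ⟨n' + (n₀ + 1), ?_⟩
    rintro q ⟨k, hk⟩
    induction q using QuotientAddGroup.induction_on with | H x => ?_
    rw [← QuotientAddGroup.mk_nsmul, QuotientAddGroup.eq_zero_iff] at hk ⊢
    refine descend x k ?_
    rw [pow_add, mul_smul]
    exact N.nsmul_mem hk _
end

section
/- Let A be a commutative ring, d ∈ A, and M an A-module with bounded d^∞-torsion, i.e. there exists n₀ such that every element of M annihilated by some power of d is annihilated by d^{n₀}. Let M̂ = lim_n M/d^n M be the classical d-adic completion of M, with its natural map M → M̂. Then for every n ≥ 1, the induced map M[d^n] → M̂[d^n] on d^n-torsion submodules is an isomorphism; in particular M̂ has bounded d^∞-torsion, with M̂[d^∞] = M̂[d^{n₀}]. -/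
theorem mem_span_singleton_pow_smul_top_iff {A M : Type*} [CommRing A] [AddCommGroup M]
    [Module A M] (d : A) (k : ℕ) (x : M) :
    x ∈ (Ideal.span {d} ^ k • ⊤ : Submodule A M) ↔ ∃ y : M, d ^ k • y = x := by
  rw [Ideal.span_singleton_pow, Submodule.ideal_span_singleton_smul,
    Submodule.mem_smul_pointwise_iff_exists]
  simp

/-- Under bounded torsion, a torsion element divisible by `d ^ n₀` vanishes. -/
theorem eq_zero_of_torsion_of_mem_pow_smul_top {A M : Type*} [CommRing A] [AddCommGroup M]
    [Module A M] {d : A} {n₀ : ℕ}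
    (hbd : ∀ x : M, (∃ n : ℕ, d ^ n • x = 0) → d ^ n₀ • x = 0) {n : ℕ} {x : M}
    (hx : d ^ n • x = 0) (hmem : x ∈ (Ideal.span {d} ^ n₀ • ⊤ : Submodule A M)) : x = 0 := by
  obtain ⟨y, rfl⟩ := (mem_span_singleton_pow_smul_top_iff d n₀ x).1 hmem
  exact hbd y ⟨n + n₀, by rw [pow_add, mul_smul, hx]⟩

theorem mkQ_eq_eval_of_le {A M : Type*} [CommRing A] [AddCommGroup M] [Module A M] {I : Ideal A}
    {ξ : AdicCompletion I M} {j k : ℕ} (hjk : j ≤ k) {x : M}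
    (hx : Submodule.mkQ (I ^ k • ⊤ : Submodule A M) x = AdicCompletion.eval I M k ξ) :
    Submodule.mkQ (I ^ j • ⊤ : Submodule A M) x = AdicCompletion.eval I M j ξ :=
  (congrArg (AdicCompletion.transitionMap I M hjk) hx).trans
    (AdicCompletion.transitionMap_comp_eval_apply I M hjk ξ)

/-- A `d ^ n`-torsion element of the completion is approximated by `d ^ n`-torsion elements. -/
theorem exists_torsion_eval_eq {A M : Type*} [CommRing A] [AddCommGroup M] [Module A M] {d : A}
    {n : ℕ} {ξ : AdicCompletion (Ideal.span {d}) M} (hξ : d ^ n • ξ = 0) (k : ℕ) :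
    ∃ t : M, d ^ n • t = 0 ∧
      Submodule.mkQ (Ideal.span {d} ^ k • ⊤ : Submodule A M) t =
        AdicCompletion.eval (Ideal.span {d}) M k ξ := by
  obtain ⟨x, hx⟩ := Submodule.mkQ_surjective _
    (AdicCompletion.eval (Ideal.span {d}) M (k + n) ξ)
  have hmem : d ^ n • x ∈ (Ideal.span {d} ^ (k + n) • ⊤ : Submodule A M) := by
    rw [← Submodule.Quotient.mk_eq_zero, ← Submodule.mkQ_apply, map_smul, hx, ← map_smul, hξ,
      map_zero]
  obtain ⟨y, hy⟩ := (mem_span_singleton_pow_smul_top_iff d (k + n) _).1 hmem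
  refine ⟨x - d ^ k • y, ?_, ?_⟩
  · rw [smul_sub, ← hy, smul_smul, ← pow_add, add_comm n k, sub_self]
  · have hy' : Submodule.mkQ (Ideal.span {d} ^ k • ⊤ : Submodule A M) (d ^ k • y) = 0 :=
      (Submodule.Quotient.mk_eq_zero _).2
        ((mem_span_singleton_pow_smul_top_iff d k _).2 ⟨y, rfl⟩)
    rw [map_sub, hy', sub_zero]
    exact mkQ_eq_eval_of_le (Nat.le_add_right k n) hx

theorem exists_torsion_of_eq {A M : Type*} [CommRing A] [AddCommGroup M] [Module A M] {d : A}
    {n₀ : ℕ} (hbd : ∀ x : M, (∃ n : ℕ, d ^ n • x = 0) → d ^ n₀ • x = 0) {n : ℕ}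
    {ξ : AdicCompletion (Ideal.span {d}) M} (hξ : d ^ n • ξ = 0) :
    ∃ x : M, d ^ n • x = 0 ∧ AdicCompletion.of (Ideal.span {d}) M x = ξ := by
  obtain ⟨t, ht, htξ⟩ := exists_torsion_eval_eq hξ n₀
  refine ⟨t, ht, AdicCompletion.ext fun k ↦ ?_⟩
  obtain ⟨s, hs, hsξ⟩ := exists_torsion_eval_eq hξ (n₀ + k)
  have hle {j : ℕ} (hj : j ≤ n₀ + k) :
      Submodule.mkQ (Ideal.span {d} ^ j • ⊤ : Submodule A M) s =
        AdicCompletion.eval (Ideal.span {d}) M j ξ :=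
    mkQ_eq_eval_of_le hj hsξ
  have hts : t - s = 0 := by
    refine eq_zero_of_torsion_of_mem_pow_smul_top hbd (n := n) (by rw [smul_sub, ht, hs, sub_zero])
      ?_
    rw [← Submodule.Quotient.mk_eq_zero, ← Submodule.mkQ_apply, map_sub, htξ,
      hle (Nat.le_add_right n₀ k), sub_self]
  rw [sub_eq_zero.1 hts]
  exact hle (Nat.le_add_left k n₀)

/-- Let `A` be a commutative ring, `d ∈ A`, and `M` an `A`-module of
bounded `d^∞`-torsion (`M[d^∞] = M[d^{n₀}]`).  Let `M̂ = lim_n M/dⁿM` be the classical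
`d`-adic completion with its natural map `M → M̂`.  Then for every `n ≥ 1` the induced
map `M[dⁿ] → M̂[dⁿ]` on `dⁿ`-torsion submodules is an isomorphism (injective and
surjective); in particular `M̂` has bounded `d^∞`-torsion with
`M̂[d^∞] = M̂[d^{n₀}]`. -/
theorem adicCompletion_torsion_of_bounded_torsion
    (A : Type*) [CommRing A] (d : A)
    (M : Type*) [AddCommGroup M] [Module A M]
    (n₀ : ℕ)
    (hbd : ∀ x : M, (∃ n : ℕ, d ^ n • x = 0) → d ^ n₀ • x = 0) :
    (∀ n : ℕ, 1 ≤ n →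
      (∀ x : M, d ^ n • x = 0 →
        AdicCompletion.of (Ideal.span {d}) M x = 0 → x = 0) ∧
      (∀ ξ : AdicCompletion (Ideal.span {d}) M, d ^ n • ξ = 0 →
        ∃ x : M, d ^ n • x = 0 ∧ AdicCompletion.of (Ideal.span {d}) M x = ξ)) ∧
    (∀ ξ : AdicCompletion (Ideal.span {d}) M, (∃ n : ℕ, d ^ n • ξ = 0) →
      d ^ n₀ • ξ = 0) := by
  refine ⟨fun n _ ↦ ⟨fun x hx h ↦ ?_, fun ξ hξ ↦ exists_torsion_of_eq hbd hξ⟩, ?_⟩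
  · refine eq_zero_of_torsion_of_mem_pow_smul_top hbd hx ?_
    rw [← Submodule.Quotient.mk_eq_zero, ← Submodule.mkQ_apply, ← AdicCompletion.eval_of, h,
      map_zero]
  · rintro ξ ⟨n, hξ⟩
    obtain ⟨x, hx, rfl⟩ := exists_torsion_of_eq hbd hξ
    rw [← map_smul, hbd x ⟨n, hx⟩, map_zero]
end

section
/- Let p be a prime, G a finite group acting by automorphisms on an abelian group M, and let e be the p-adic valuation of the order of G. Assume M has bounded p^∞-torsion with M[p^∞] = M[p^{n₀}]. Then for every n ≥ n₀ one has p^{n+e}M ∩ M^G ⊆ p^n · M^G, where M^G denotes the subgroup of G-fixed points; hence the topology induced on M^G by the p-adic topology of M coincides with the p-adic topology of M^G. Moreover, if M is p-adically complete, then the natural map M^G → lim_n (M/p^n M)^G is an isomorphism. -/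
theorem Submodule.mem_span_natCast_pow_smul_top_iff {M : Type*} [AddCommGroup M]
    (p n : ℕ) (x : M) :
    x ∈ ((Ideal.span {(p : ℤ)}) ^ n • ⊤ : Submodule ℤ M) ↔ ∃ z : M, x = (p ^ n) • z := by
  rw [Ideal.span_singleton_pow, Submodule.ideal_span_singleton_smul,
    Submodule.mem_smul_pointwise_iff_exists]
  have key (z : M) : ((p : ℤ) ^ n) • z = (p ^ n) • z := by
    rw [← natCast_zsmul, Nat.cast_pow]
  simp [key, eq_comm]

theorem sum_smul_fixed {G M : Type*} [Group G] [Fintype G] [AddCommMonoid M]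
    [DistribMulAction G M] (g : G) (z : M) : g • ∑ h : G, h • z = ∑ h : G, h • z := by
  rw [Finset.smul_sum]
  simp only [← mul_smul]
  exact Fintype.sum_equiv (Equiv.mulLeft g) _ _ fun _ => rfl

/-- If the `p`-power torsion is killed by `p ^ n₀`, then the fixed points in `p ^ (n + e) M` lie in
`p ^ n` times the fixed points. -/
theorem exists_fixed_eq_pow_smul {p : ℕ} (hp : p.Prime) {G : Type*} [Group G] [Fintype G]
    {M : Type*} [AddCommGroup M] [DistribMulAction G M]
    {n₀ : ℕ} (hbd : ∀ x : M, (∃ n : ℕ, (p ^ n) • x = 0) → (p ^ n₀) • x = 0)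
    {n : ℕ} (hn : n₀ ≤ n) {x : M} (hx : ∀ g : G, g • x = x)
    (hz : ∃ z : M, x = (p ^ (n + padicValNat p (Fintype.card G))) • z) :
    ∃ w : M, (∀ g : G, g • w = w) ∧ x = (p ^ n) • w := by
  obtain ⟨z, hz⟩ := hz
  obtain ⟨m, hm, hcard⟩ : ∃ m : ℕ, ¬ p ∣ m ∧
      Fintype.card G = p ^ padicValNat p (Fintype.card G) * m := by
    rw [← Nat.factorization_def _ hp]
    exact ⟨_, Nat.not_dvd_ordCompl hp Fintype.card_ne_zero,
      (Nat.ordProj_mul_ordCompl_eq_self _ p).symm⟩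
  have fixed (g : G) : (p ^ n) • g • z = (p ^ n) • z := by
    have h0 : (p ^ n₀) • (g • z - z) = 0 := by
      refine hbd _ ⟨n + padicValNat p (Fintype.card G), ?_⟩
      rw [smul_sub, smul_comm _ g z, ← hz, hx, sub_self]
    rw [← sub_eq_zero, ← smul_sub, ← Nat.sub_add_cancel hn, pow_add, mul_smul, h0, smul_zero]
  have norm_eq : (p ^ n) • ∑ h : G, h • z = m • x := by
    rw [Finset.smul_sum, Finset.sum_congr rfl fun h _ => fixed h, Finset.sum_const,
      Finset.card_univ, hz, ← mul_smul, ← mul_smul, pow_add]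
    congr 1
    conv_lhs => rw [hcard]
    ring
  have coprime : IsCoprime (m : ℤ) ((p ^ n : ℕ) : ℤ) :=
    Nat.isCoprime_iff_coprime.2 (((Nat.Prime.coprime_iff_not_dvd hp).2 hm).symm.pow_right n)
  obtain ⟨a, b, hab⟩ := coprime
  refine ⟨a • ∑ h : G, h • z + b • x, fun g => ?_, ?_⟩
  · rw [smul_add, smul_comm g a, smul_comm g b, sum_smul_fixed, hx]
  · rw [smul_add, smul_comm _ a, norm_eq, smul_comm _ b, ← natCast_zsmul x m,
      ← natCast_zsmul x (p ^ n), ← mul_smul, ← mul_smul, ← add_smul, hab, one_smul]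


/-- Let `G` be a finite group acting on an abelian group `M` of
bounded `p^∞`-torsion (`M[p^∞] = M[p^{n₀}]`) and let `e = v_p(|G|)`.  Then for all
`n ≥ n₀` one has `p^{n+e}M ∩ M^G ⊆ pⁿ·M^G`; moreover, if `M` is `p`-adically
complete then the natural map `M^G → lim_n (M/pⁿM)^G` is an isomorphism (injective,
and every compatible system of `G`-fixed classes comes from a `G`-fixed element). -/
theorem fixed_points_complete
    (p : ℕ) (hp : p.Prime) (G : Type*) [Group G] [Fintype G]
    (M : Type*) [AddCommGroup M] [DistribMulAction G M]
    (n₀ : ℕ) (hbd : ∀ x : M, (∃ n : ℕ, (p ^ n) • x = 0) → (p ^ n₀) • x = 0) :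
    (∀ n : ℕ, n₀ ≤ n → ∀ x : M, (∀ g : G, g • x = x) →
      (∃ z : M, x = (p ^ (n + padicValNat p (Fintype.card G))) • z) →
      ∃ w : M, (∀ g : G, g • w = w) ∧ x = (p ^ n) • w) ∧
    (IsAdicComplete (Ideal.span {(p : ℤ)}) M →
      (∀ x y : M, (∀ g : G, g • x = x) → (∀ g : G, g • y = y) →
        (∀ n : ℕ, ∃ z : M, x - y = (p ^ n) • z) → x = y) ∧
      (∀ c : ℕ → M,
        (∀ (n : ℕ) (g : G), ∃ z : M, g • c n - c n = (p ^ n) • z) →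
        (∀ m n : ℕ, m ≤ n → ∃ z : M, c n - c m = (p ^ m) • z) →
        ∃ x : M, (∀ g : G, g • x = x) ∧ ∀ n : ℕ, ∃ z : M, x - c n = (p ^ n) • z)) := by
  refine ⟨fun n hn x hx hz => exists_fixed_eq_pow_smul hp hbd hn hx hz, fun hM => ?_⟩
  have separated (x y : M) (h : ∀ n : ℕ, ∃ z : M, x - y = (p ^ n) • z) : x = y := by
    refine sub_eq_zero.1 (hM.toIsHausdorff.haus (x - y) fun n => ?_)
    rw [SModEq.zero]
    exact (Submodule.mem_span_natCast_pow_smul_top_iff p n _).2 (h n)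
  refine ⟨fun x y _ _ h => separated x y h, fun c hc hcc => ?_⟩
  obtain ⟨x, hx⟩ := hM.toIsPrecomplete.prec (f := c) fun {m n} hmn => by
    rw [SModEq.comm, SModEq.sub_mem]
    exact (Submodule.mem_span_natCast_pow_smul_top_iff p m _).2 (hcc m n hmn)
  have approx (n : ℕ) : ∃ z : M, x - c n = (p ^ n) • z :=
    (Submodule.mem_span_natCast_pow_smul_top_iff p n _).1 (SModEq.sub_mem.1 (hx n).symm)
  refine ⟨x, fun g => separated _ _ fun n => ?_, approx⟩
  obtain ⟨z, hz⟩ := approx n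
  obtain ⟨y, hy⟩ := hc n g
  refine ⟨g • z + y - z, ?_⟩
  rw [smul_sub, smul_add, smul_comm _ g z, ← hz, ← hy, smul_sub]
  abel
end

section
/- Let p be a prime and C an abelian group such that C = pC and such that every group homomorphism from ℤ[1/p] to C is zero. Then C = 0. -/
/-- The module of sequences `c` in `M` with `c n = r • c (n + 1)` for all `n`, i.e. the inverse
limit of `M` along multiplication by `r`. -/
def divisionSequences {R : Type*} [CommRing R] (r : R) (M : Type*) [AddCommGroup M] [Module R M] :
    Submodule R (ℕ → M) where
  carrier := {c | ∀ n, c n = r • c (n + 1)}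
  add_mem' := fun {a b} ha hb n => by
    rw [Pi.add_apply, Pi.add_apply, smul_add, ← ha n, ← hb n]
  zero_mem' := fun n => by simp
  smul_mem' := fun k a ha n => by
    rw [Pi.smul_apply, Pi.smul_apply, smul_comm, ← ha n]

theorem divisionSequences.isUnit_algebraMap {R : Type*} [CommRing R] (r : R) (M : Type*)
    [AddCommGroup M] [Module R M] :
    IsUnit (algebraMap R (Module.End R (divisionSequences r M)) r) := by
  rw [Module.End.isUnit_iff]
  constructor
  · rw [injective_iff_map_eq_zero]
    intro c hc
    ext n
    have h := congrFun (congrArg Subtype.val hc) (n + 1)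
    exact (c.2 n).trans h
  · intro c
    refine ⟨⟨fun n => c.1 (n + 1), fun n => c.2 (n + 1)⟩, ?_⟩
    ext n
    exact (c.2 n).symm

theorem exists_linearMap_away_apply_one {R : Type*} [CommRing R] {r : R} {M : Type*}
    [AddCommGroup M] [Module R M] (c : divisionSequences r M) :
    ∃ f : Localization.Away r →ₗ[R] M, f 1 = c.1 0 := by
  have hunit : ∀ s : Submonoid.powers r,
      IsUnit (algebraMap R (Module.End R (divisionSequences r M)) s) := by
    rintro ⟨_, n, rfl⟩
    rw [map_pow]
    exact (divisionSequences.isUnit_algebraMap r M).pow n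
  let φ := IsLocalizedModule.lift (Submonoid.powers r)
    (Algebra.linearMap R (Localization.Away r))
    (LinearMap.toSpanSingleton R (divisionSequences r M) c) hunit
  have hφ : φ 1 = c := by
    have h := IsLocalizedModule.lift_apply (Submonoid.powers r)
      (Algebra.linearMap R (Localization.Away r))
      (LinearMap.toSpanSingleton R (divisionSequences r M) c) hunit 1
    simpa using h
  refine ⟨(LinearMap.proj 0 ∘ₗ (divisionSequences r M).subtype) ∘ₗ φ, ?_⟩
  exact congrArg (fun d : divisionSequences r M => d.1 0) hφ

/-- Let `C` be an abelian group with `C = pC` (for a prime `p`) such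
that every group homomorphism `ℤ[1/p] → C` is zero.  Then `C = 0`. -/
theorem divisible_group_with_no_hom_from_z_inv_p_is_zero
    (p : ℕ) (hp : p.Prime) (C : Type*) [AddCommGroup C]
    (hdiv : ∀ x : C, ∃ y : C, x = p • y)
    (hhom : ∀ f : Localization.Away (p : ℤ) →+ C, f = 0) :
    ∀ x : C, x = 0 := by
  intro x
  choose d hd using hdiv
  have hc : (fun n => d^[n] x) ∈ divisionSequences (p : ℤ) C := fun n => by
    simp only [Function.iterate_succ_apply', natCast_zsmul, ← hd]
  obtain ⟨f, hf⟩ := exists_linearMap_away_apply_one ⟨_, hc⟩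
  exact hf.symm.trans (DFunLike.congr_fun (hhom f.toAddMonoidHom) 1)
end
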